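/- arXiv:1310.4243 — 8 statements merged into one kernel-verified Lean document; each statement's English description precedes it below -/
import Mathlib

section
/- Let a, b, c1, c2 ∈ ℂ satisfy Re(c1) > Re(a) > 0 and Re(c2) > Re(b) > 0. There exists ε > 0 such that for all real x1, x2 with 0 < x1 < ε and 0 < x2 < ε the following holds: the open set U = {(t1,t2) ∈ ℝ² : t1 > 0, t2 > 0, 1 − t1 + t1t2x2 > 0, 1 − t2 + t1t2x1 > 0} has exactly one bounded connected component D, the function (t1,t2) ↦ t1^{a−1} t2^{b−1} (1 − t1 + t1t2x2)^{c1−a−1} (1 − t2 + t1t2x1)^{c2−b−1} is Lebesgue integrable on D (here t^w = exp(w · log t) for real t > 0 and w ∈ ℂ), and (Γ(c1)Γ(c2) / (Γ(a)Γ(b)Γ(c1−a)Γ(c2−b))) · ∫_D t1^{a−1} t2^{b−1} (1 − t1 + t1t2x2)^{c1−a−1} (1 − t2 + t1t2x1)^{c2−b−1} dt1 dt2 = F4(a,b,c1,c2;(x1,x2)). -/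
open Complex MeasureTheory

/-- Appell's hypergeometric series `F₄(a,b,c₁,c₂;x)`. -/
noncomputable def appellF4 (a b c1 c2 : ℂ) (x : ℂ × ℂ) : ℂ :=
  ∑' n : ℕ × ℕ,
    ((ascPochhammer ℂ (n.1 + n.2)).eval a * (ascPochhammer ℂ (n.1 + n.2)).eval b) /
      ((ascPochhammer ℂ n.1).eval c1 * (ascPochhammer ℂ n.2).eval c2 *
        (Nat.factorial n.1 : ℂ) * (Nat.factorial n.2 : ℂ)) * x.1 ^ n.1 * x.2 ^ n.2

/-- The open set `U` cut out by `t₁ > 0`, `t₂ > 0`, `1 - t₁ + t₁t₂x₂ > 0`,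
`1 - t₂ + t₁t₂x₁ > 0`. -/
def eulerDomain (x1 x2 : ℝ) : Set (ℝ × ℝ) :=
  {t : ℝ × ℝ | 0 < t.1 ∧ 0 < t.2 ∧ 0 < 1 - t.1 + t.1 * t.2 * x2 ∧
    0 < 1 - t.2 + t.1 * t.2 * x1}

/-- The integrand `t₁^(a-1) t₂^(b-1) (1-t₁+t₁t₂x₂)^(c₁-a-1) (1-t₂+t₁t₂x₁)^(c₂-b-1)`,
where `t^w = exp (w log t)` for real `t > 0`. -/
noncomputable def eulerIntegrand (a b c1 c2 : ℂ) (x1 x2 : ℝ) (t : ℝ × ℝ) : ℂ :=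
  (t.1 : ℂ) ^ (a - 1) * (t.2 : ℂ) ^ (b - 1) *
    ((1 - t.1 + t.1 * t.2 * x2 : ℝ) : ℂ) ^ (c1 - a - 1) *
    ((1 - t.2 + t.1 * t.2 * x1 : ℝ) : ℂ) ^ (c2 - b - 1)

/-- A bounded connected component of the set `eulerDomain x1 x2`. -/
def IsBddComponent (x1 x2 : ℝ) (D : Set (ℝ × ℝ)) : Prop :=
  (∃ p ∈ eulerDomain x1 x2, D = connectedComponentIn (eulerDomain x1 x2) p) ∧
    Bornology.IsBounded D

/-- The coefficient of `y₁ⁿ¹ y₂ⁿ²` in the two-variable generating function of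
`hasSum_appellCoeff`. -/
noncomputable def appellCoeff (c1 c2 : ℂ) (n : ℕ × ℕ) : ℂ :=
  ((ascPochhammer ℂ n.2).eval (c1 + n.1) / (n.2.factorial : ℂ)) *
    ((ascPochhammer ℂ n.1).eval (c2 + n.2) / (n.1.factorial : ℂ))

lemma ringChoose_eq_ascPochhammer_div (z : ℂ) (k : ℕ) :
    Ring.choose (z + k - 1) k = (ascPochhammer ℂ k).eval z / (k.factorial : ℂ) := by
  rw [← Ring.multichoose_eq, eq_div_iff (by exact_mod_cast k.factorial_ne_zero), mul_comm,
    ← nsmul_eq_mul, Ring.factorial_nsmul_multichoose_eq_ascPochhammer,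
    Polynomial.ascPochhammer_smeval_eq_eval]

lemma norm_ascPochhammer_eval_div_factorial_le {z : ℂ} {N : ℕ} (hz : ‖z‖ ≤ N) (k : ℕ) :
    ‖(ascPochhammer ℂ k).eval z / (k.factorial : ℂ)‖ ≤ 2 ^ (N + k) := by
  have h : ‖(ascPochhammer ℂ k).eval z‖ ≤ ((N + 1).ascFactorial k : ℕ) := by
    induction k with
    | zero => simp
    | succ k ih =>
      rw [ascPochhammer_succ_eval, norm_mul, Nat.ascFactorial_succ, mul_comm, Nat.cast_mul]
      gcongr
      calc ‖z + k‖ ≤ ‖z‖ + ‖(k : ℂ)‖ := norm_add_le _ _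
        _ ≤ N + k := by simpa using hz
        _ ≤ ((N + 1 + k : ℕ) : ℝ) := by push_cast; linarith
  rw [norm_div, Complex.norm_natCast, div_le_iff₀ (by positivity)]
  refine h.trans ?_
  rw [Nat.ascFactorial_eq_factorial_mul_choose, Nat.cast_mul, mul_comm]
  gcongr
  exact_mod_cast Nat.choose_le_two_pow _ _

lemma exists_norm_appellCoeff_le (c1 c2 : ℂ) :
    ∃ K : ℝ, ∀ n : ℕ × ℕ, ‖appellCoeff c1 c2 n‖ ≤ K * (4 ^ n.1 * 4 ^ n.2) := by
  obtain ⟨N1, h1⟩ := exists_nat_ge ‖c1‖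
  obtain ⟨N2, h2⟩ := exists_nat_ge ‖c2‖
  have hadd {c : ℂ} {N : ℕ} (h : ‖c‖ ≤ N) (k : ℕ) : ‖c + k‖ ≤ ((N + k : ℕ) : ℝ) := by
    calc ‖c + k‖ ≤ ‖c‖ + ‖(k : ℂ)‖ := norm_add_le _ _
      _ ≤ _ := by simpa using h
  refine ⟨2 ^ N1 * 2 ^ N2, fun n => ?_⟩
  rw [appellCoeff, norm_mul]
  calc _ ≤ (2 : ℝ) ^ (N1 + n.1 + n.2) * 2 ^ (N2 + n.2 + n.1) := by
        gcongr
        · exact norm_ascPochhammer_eval_div_factorial_le (hadd h1 n.1) n.2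
        · exact norm_ascPochhammer_eval_div_factorial_le (hadd h2 n.2) n.1
    _ = _ := by
        rw [show (4 : ℝ) = 2 * 2 by norm_num]
        simp only [mul_pow, pow_add]
        ring

lemma summable_norm_appellCoeff (c1 c2 : ℂ) {r1 r2 : ℝ} (h1 : 0 ≤ r1) (h1' : r1 < 1 / 4)
    (h2 : 0 ≤ r2) (h2' : r2 < 1 / 4) :
    Summable fun n : ℕ × ℕ => ‖appellCoeff c1 c2 n‖ * (r1 ^ n.1 * r2 ^ n.2) := by
  obtain ⟨K, hK⟩ := exists_norm_appellCoeff_le c1 c2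
  have hs : Summable fun n : ℕ × ℕ => (4 * r1) ^ n.1 * (4 * r2) ^ n.2 :=
    (summable_geometric_of_lt_one (by positivity) (by linarith)).mul_of_nonneg
      (summable_geometric_of_lt_one (by positivity) (by linarith))
      (fun _ => by positivity) (fun _ => by positivity)
  refine Summable.of_nonneg_of_le (fun n => by positivity) (fun n => ?_) (hs.mul_left K)
  calc _ ≤ K * (4 ^ n.1 * 4 ^ n.2) * (r1 ^ n.1 * r2 ^ n.2) := by gcongr; exact hK n
    _ = _ := by simp only [mul_pow]; ring

/-- Cauchy's formula for the coefficients of a convergent power series. -/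
lemma circleIntegral_eq_coeff {f : ℂ → ℂ} {u : ℕ → ℂ} {R : ℝ} (hR : 0 < R)
    (hf : DifferentiableOn ℂ f (Metric.closedBall 0 R))
    (hu : ∀ᶠ z in nhds (0 : ℂ), HasSum (fun n => z ^ n * u n) (f z)) (n : ℕ) :
    (2 * Real.pi * I : ℂ)⁻¹ * ∮ z in C(0, R), z⁻¹ ^ n * (z⁻¹ * f z) = u n := by
  lift R to NNReal using hR.le
  have h1 := (hf.hasFPowerSeriesOnBall hR).hasFPowerSeriesAt
  have h2 : HasFPowerSeriesAt f (FormalMultilinearSeries.ofScalars ℂ u) 0 := by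
    rw [hasFPowerSeriesAt_iff]
    simpa using hu
  have h3 := cauchyPowerSeries_apply f 0 R n 1
  rw [h1.eq_formalMultilinearSeries h2, FormalMultilinearSeries.ofScalars_apply_eq] at h3
  simpa using h3.symm

lemma summable_hasSum_one_add_mul_cpow (A : ℂ) {y z : ℂ} (h : ‖y * z‖ < 1) :
    (Summable fun n : ℕ => ‖Ring.choose A n * y ^ n * z ^ n‖) ∧
      HasSum (fun n : ℕ => Ring.choose A n * y ^ n * z ^ n) ((1 + y * z) ^ A) := by
  have hB := Complex.one_add_cpow_hasFPowerSeriesOnBall_zero (a := A)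
  have hm : y * z ∈ Metric.eball (0 : ℂ) 1 := by
    simpa [← ENNReal.ofReal_one, Metric.eball_ofReal] using h
  have h1 := hB.hasSum hm
  have h2 := FormalMultilinearSeries.summable_norm_apply (binomialSeries ℂ A)
    (Metric.eball_subset_eball hB.r_le hm)
  have e (n : ℕ) : (binomialSeries ℂ A n fun _ => y * z) = Ring.choose A n * y ^ n * z ^ n := by
    simp only [binomialSeries_apply, List.ofFn_const, List.prod_replicate, smul_eq_mul, mul_pow]
    ring
  simp only [e, zero_add] at h1 h2
  exact ⟨h2, h1⟩

lemma hasSum_one_add_mul_cpow_mul (A B : ℂ) {y1 y2 z : ℂ} (h1 : ‖y1 * z‖ < 1)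
    (h2 : ‖y2 * z‖ < 1) :
    HasSum (fun n : ℕ => z ^ n * ∑ k ∈ Finset.HasAntidiagonal.antidiagonal n,
        Ring.choose B k.1 * Ring.choose A k.2 * y1 ^ k.1 * y2 ^ k.2)
      ((1 + y2 * z) ^ A * (1 + y1 * z) ^ B) := by
  obtain ⟨s1, t1⟩ := summable_hasSum_one_add_mul_cpow B h1
  obtain ⟨s2, t2⟩ := summable_hasSum_one_add_mul_cpow A h2
  have hs := (summable_norm_sum_mul_antidiagonal_of_summable_norm s1 s2).of_norm.hasSum
  rw [← tsum_mul_tsum_eq_tsum_sum_antidiagonal_of_summable_norm s1 s2, t1.tsum_eq, t2.tsum_eq,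
    mul_comm] at hs
  refine hs.congr_fun fun n => ?_
  rw [Finset.mul_sum]
  refine Finset.sum_congr rfl fun k hk => ?_
  rw [← Finset.HasAntidiagonal.mem_antidiagonal.1 hk, pow_add]
  ring

lemma one_add_ne_zero_of_norm_lt_one {w : ℂ} (hw : ‖w‖ < 1) : 1 + w ≠ 0 :=
  slitPlane_ne_zero (mem_slitPlane_of_norm_lt_one hw)

/-- The antidiagonal sums of the generating series, as Cauchy integrals. -/
lemma circleIntegral_eq_sum_appellCoeff (c1 c2 : ℂ) {y1 y2 : ℂ} (h1 : ‖y1‖ ≤ 1 / 16)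
    (h2 : ‖y2‖ ≤ 1 / 16) (n : ℕ) :
    (2 * Real.pi * I : ℂ)⁻¹ * ∮ z in C(0, 2), z⁻¹ ^ n * (z⁻¹ *
        ((1 + y2 * z) ^ (c1 - 1) * (1 + y1 * z) ^ (c2 - 1) *
          ((1 + y1 * z) * (1 + y2 * z)) ^ n)) =
      ∑ k ∈ Finset.HasAntidiagonal.antidiagonal n,
        appellCoeff c1 c2 k * (y1 ^ k.1 * y2 ^ k.2) := by
  have hy {y z : ℂ} (hy : ‖y‖ ≤ 1 / 16) (hz : ‖z‖ ≤ 2) : ‖y * z‖ < 1 := by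
    rw [norm_mul]
    nlinarith [norm_nonneg y, norm_nonneg z]
  have key := circleIntegral_eq_coeff (R := 2)
    (f := fun z => (1 + y2 * z) ^ (c1 - 1 + n) * (1 + y1 * z) ^ (c2 - 1 + n))
    (u := fun m => ∑ k ∈ Finset.HasAntidiagonal.antidiagonal m,
        Ring.choose (c2 - 1 + n) k.1 * Ring.choose (c1 - 1 + n) k.2 * y1 ^ k.1 * y2 ^ k.2)
    two_pos ?_ ?_ n
  · rw [circleIntegral.integral_congr (g := fun z => z⁻¹ ^ n * (z⁻¹ *
        ((1 + y2 * z) ^ (c1 - 1 + n) * (1 + y1 * z) ^ (c2 - 1 + n)))) two_pos.le, key]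
    · refine Finset.sum_congr rfl fun k hk => ?_
      rw [appellCoeff, ← ringChoose_eq_ascPochhammer_div, ← ringChoose_eq_ascPochhammer_div,
        ← Finset.HasAntidiagonal.mem_antidiagonal.1 hk]
      push_cast
      ring_nf
    · intro z hz
      have hz' : ‖z‖ ≤ 2 := by simpa using (mem_sphere_zero_iff_norm.1 hz).le
      simp only
      rw [cpow_add _ _ (one_add_ne_zero_of_norm_lt_one (hy h1 hz')),
        cpow_add _ _ (one_add_ne_zero_of_norm_lt_one (hy h2 hz')), cpow_natCast, cpow_natCast, mul_pow]
      ring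
  · intro z hz
    have hz' : ‖z‖ ≤ 2 := by simpa using hz
    refine DifferentiableAt.differentiableWithinAt (.mul ?_ ?_)
    · exact DifferentiableAt.cpow (by fun_prop) (by fun_prop)
        (mem_slitPlane_of_norm_lt_one (hy h2 hz'))
    · exact DifferentiableAt.cpow (by fun_prop) (by fun_prop)
        (mem_slitPlane_of_norm_lt_one (hy h1 hz'))
  · filter_upwards [Metric.closedBall_mem_nhds (0 : ℂ) two_pos] with z hz
    have hz' : ‖z‖ ≤ 2 := by simpa using hz
    exact hasSum_one_add_mul_cpow_mul _ _ (hy h1 hz') (hy h2 hz')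

/-- Lagrange inversion for `v = (1 + y₁v)(1 + y₂v)`, in the form of a two-variable generating
function. -/
lemma hasSum_appellCoeff (c1 c2 : ℂ) {y1 y2 v : ℂ} (h1 : ‖y1‖ ≤ 1 / 16)
    (h2 : ‖y2‖ ≤ 1 / 16) (hv : ‖v‖ < 2) (hveq : v = (1 + y1 * v) * (1 + y2 * v)) :
    HasSum (fun n : ℕ × ℕ => appellCoeff c1 c2 n * (y1 ^ n.1 * y2 ^ n.2))
      ((1 + y2 * v) ^ c1 * (1 + y1 * v) ^ c2 / (1 - y1 * y2 * v ^ 2)) := by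
  have hn {y z : ℂ} (hy : ‖y‖ ≤ 1 / 16) (hz : ‖z‖ ≤ 2) : ‖y * z‖ ≤ 1 / 8 := by
    rw [norm_mul]
    nlinarith [norm_nonneg y, norm_nonneg z]
  have hy {y z : ℂ} (h : ‖y‖ ≤ 1 / 16) (hz : ‖z‖ ≤ 2) : ‖y * z‖ < 1 :=
    (hn h hz).trans_lt (by norm_num)
  have hone {y z : ℂ} (h : ‖y‖ ≤ 1 / 16) (hz : ‖z‖ ≤ 2) : ‖1 + y * z‖ ≤ 9 / 8 := by
    have := norm_add_le 1 (y * z)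
    rw [norm_one] at this
    linarith [hn h hz]
  set F : ℂ → ℂ := fun z => (1 + y2 * z) ^ (c1 - 1) * (1 + y1 * z) ^ (c2 - 1) with hF
  have hFd : DifferentiableOn ℂ F (Metric.closedBall 0 2) := by
    intro z hz
    have hz' : ‖z‖ ≤ 2 := by simpa using hz
    refine DifferentiableAt.differentiableWithinAt (.mul ?_ ?_)
    · exact DifferentiableAt.cpow (by fun_prop) (by fun_prop)
        (mem_slitPlane_of_norm_lt_one (hy h2 hz'))
    · exact DifferentiableAt.cpow (by fun_prop) (by fun_prop)
        (mem_slitPlane_of_norm_lt_one (hy h1 hz'))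
  set Q : ℂ → ℂ := fun z => 1 - y1 - y2 - y1 * y2 * (z + v) with hQ
  have hQ0 (z : ℂ) (hz : ‖z‖ ≤ 2) : Q z ≠ 0 := by
    intro h0
    have e : (1 : ℂ) = y1 + y2 + y1 * (y2 * (z + v)) := by
      linear_combination h0
    have e' : ‖y2 * (z + v)‖ ≤ 1 / 4 := by
      rw [mul_add]
      linarith [norm_add_le (y2 * z) (y2 * v), hn h2 hz, hn h2 hv.le]
    have := norm_add_le (y1 + y2) (y1 * (y2 * (z + v)))
    rw [← e, norm_one, norm_mul] at this
    nlinarith [norm_add_le y1 y2, norm_nonneg y1, norm_nonneg (y2 * (z + v))]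
  set φ : ℂ → ℂ := fun z => (1 + y1 * z) * (1 + y2 * z) with hφ
  have hsub (z : ℂ) : z - φ z = (z - v) * Q z := by
    simp only [hφ, hQ]
    linear_combination hveq
  have hφn {z : ℂ} (hz : ‖z‖ = 2) : ‖φ z * z⁻¹‖ ≤ 81 / 128 := by
    rw [hφ, norm_mul, norm_inv, hz, norm_mul]
    nlinarith [hone h1 hz.le, hone h2 hz.le, norm_nonneg (1 + y1 * z), norm_nonneg (1 + y2 * z)]
  have hsphere (θ : ℝ) : ‖circleMap 0 2 θ‖ = 2 := by simp
  have hFc : Continuous fun θ : ℝ => F (circleMap 0 2 θ) :=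
    hFd.continuousOn.comp_continuous (by fun_prop) fun θ => by simp
  have hsum : HasSum (fun n : ℕ => ∮ z in C(0, 2), z⁻¹ ^ n * (z⁻¹ * (F z * φ z ^ n)))
      (∮ z in C(0, 2), (z - v)⁻¹ • (F z / Q z)) := by
    refine intervalIntegral.hasSum_integral_of_dominated_convergence
      (fun n θ => ‖F (circleMap 0 2 θ)‖ * (81 / 128) ^ n) (fun n => ?_) (fun n => ?_) ?_ ?_ ?_
    · have : Continuous fun θ => (circleMap 0 2 θ)⁻¹ :=
        (continuous_circleMap 0 2).inv₀ fun θ => norm_ne_zero_iff.1 (by simp)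
      have hφc : Continuous fun θ => φ (circleMap 0 2 θ) := by fun_prop
      simp only [deriv_circleMap]
      exact Continuous.aestronglyMeasurable <| Continuous.smul
        ((continuous_circleMap 0 2).mul continuous_const)
          ((this.pow n).mul (this.mul (hFc.mul (hφc.pow n))))
    · refine Filter.Eventually.of_forall fun θ _ => ?_
      have e : ‖deriv (circleMap 0 2) θ • ((circleMap 0 2 θ)⁻¹ ^ n * ((circleMap 0 2 θ)⁻¹ *
          (F (circleMap 0 2 θ) * φ (circleMap 0 2 θ) ^ n)))‖ =
          ‖F (circleMap 0 2 θ)‖ * ‖φ (circleMap 0 2 θ) * (circleMap 0 2 θ)⁻¹‖ ^ n := by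
        simp only [norm_smul, norm_mul, norm_pow, norm_inv, hsphere, mul_pow, deriv_circleMap,
          norm_I]
        ring
      rw [e]
      gcongr
      exact hφn (hsphere θ)
    · exact Filter.Eventually.of_forall fun _ _ =>
        (summable_geometric_of_lt_one (by norm_num) (by norm_num)).mul_left _
    · simp only [tsum_mul_left]
      exact Continuous.intervalIntegrable (hFc.norm.mul continuous_const) _ _
    · refine Filter.Eventually.of_forall fun θ _ => HasSum.const_smul _ ?_
      set z := circleMap 0 2 θ with hz
      have hz2 : ‖z‖ = 2 := hsphere θ
      have hz0 : z ≠ 0 := norm_ne_zero_iff.1 (by rw [hz2]; norm_num)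
      have hzv : z - v ≠ 0 := sub_ne_zero.2 (by rintro rfl; exact hv.ne hz2)
      have hg := (hasSum_geometric_of_norm_lt_one
        ((hφn hz2).trans_lt (by norm_num))).mul_left (F z * z⁻¹)
      have e : (z - v)⁻¹ • (F z / Q z) = F z * z⁻¹ * (1 - φ z * z⁻¹)⁻¹ := by
        have e1 : 1 - φ z * z⁻¹ = (z - v) * Q z * z⁻¹ := by
          rw [← hsub, sub_mul, mul_inv_cancel₀ hz0]
        have e2 := hQ0 z hz2.le
        rw [e1, smul_eq_mul]
        generalize F z = f, Q z = q at e2 ⊢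
        field_simp
      simp only [e]
      refine hg.congr_fun fun n => ?_
      simp only [mul_pow (φ z)]
      generalize φ z = p, F z = f
      ring
  have hcauchy := DifferentiableOn.circleIntegral_sub_inv_smul (f := fun z => F z / Q z)
    (hFd.div (by fun_prop) fun z hz => hQ0 z (by simpa using hz))
    (show v ∈ Metric.ball (0 : ℂ) 2 by simpa using hv)
  have hsum' := hsum.mul_left (2 * Real.pi * I : ℂ)⁻¹
  rw [hcauchy, smul_eq_mul, inv_mul_cancel_left₀ two_pi_I_ne_zero] at hsum'
  simp only [hF, hφ, circleIntegral_eq_sum_appellCoeff c1 c2 h1 h2] at hsum'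
  have hs : Summable fun n : ℕ × ℕ => appellCoeff c1 c2 n * (y1 ^ n.1 * y2 ^ n.2) :=
    Summable.of_norm <| by
      simpa using summable_norm_appellCoeff c1 c2 (norm_nonneg y1) (by linarith)
        (norm_nonneg y2) (by linarith)
  have hval : (1 + y2 * v) ^ (c1 - 1) * (1 + y1 * v) ^ (c2 - 1) / Q v =
      (1 + y2 * v) ^ c1 * (1 + y1 * v) ^ c2 / (1 - y1 * y2 * v ^ 2) := by
    have n1 := one_add_ne_zero_of_norm_lt_one (hy h1 hv.le)
    have n2 := one_add_ne_zero_of_norm_lt_one (hy h2 hv.le)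
    have hv0 : v ≠ 0 := by rw [hveq]; exact mul_ne_zero n1 n2
    have hq : v * Q v = 1 - y1 * y2 * v ^ 2 := by
      simp only [hQ]
      linear_combination hveq
    rw [← hq, cpow_sub _ _ n1, cpow_sub _ _ n2, cpow_one, cpow_one, div_mul_div_comm,
      div_div, div_eq_div_iff (mul_ne_zero (mul_ne_zero n2 n1) (hQ0 v hv.le))
        (mul_ne_zero hv0 (hQ0 v hv.le))]
    linear_combination (1 + y2 * v) ^ c1 * (1 + y1 * v) ^ c2 * Q v * hveq
  rw [← hval]
  have hσ := (Finset.HasAntidiagonal.sigmaAntidiagonalEquivProd (A := ℕ)).hasSum_iff.2 hs.hasSum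
  have hσ' := hσ.sigma (fun n => hasSum_fintype _)
  have : ∀ n : ℕ, ∑ k : Finset.HasAntidiagonal.antidiagonal n,
      ((fun n : ℕ × ℕ => appellCoeff c1 c2 n * (y1 ^ n.1 * y2 ^ n.2)) ∘
        (Finset.HasAntidiagonal.sigmaAntidiagonalEquivProd (A := ℕ))) ⟨n, k⟩ =
      ∑ k ∈ Finset.HasAntidiagonal.antidiagonal n,
        appellCoeff c1 c2 k * (y1 ^ k.1 * y2 ^ k.2) := fun n => by
    rw [← Finset.sum_coe_sort (Finset.HasAntidiagonal.antidiagonal n)]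
    rfl
  simp only [this] at hσ'
  rw [hsum'.unique hσ']
  exact hs.hasSum

/-- The bounded component of `eulerDomain x1 x2` for small `x1, x2`. -/
def eulerRegion (x1 x2 : ℝ) : Set (ℝ × ℝ) :=
  {t : ℝ × ℝ | t ∈ eulerDomain x1 x2 ∧ t.1 * t.2 < 2}

section Geometry

variable {x1 x2 : ℝ}

lemma lt_of_mem_eulerRegion (h1' : x1 < 1 / 16) (h2' : x2 < 1 / 16) {t : ℝ × ℝ}
    (ht : t ∈ eulerRegion x1 x2) : t.1 < 9 / 8 ∧ t.2 < 9 / 8 := by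
  obtain ⟨⟨p1, p2, h3, h4⟩, h5⟩ := ht
  have hw := mul_pos p1 p2
  constructor
  · nlinarith [mul_pos hw (sub_pos.2 h2')]
  · nlinarith [mul_pos hw (sub_pos.2 h1')]

lemma mul_ne_two_of_mem_eulerDomain (h1 : 0 < x1) (h1' : x1 < 1 / 16) (h2' : x2 < 1 / 16)
    {t : ℝ × ℝ} (ht : t ∈ eulerDomain x1 x2) : t.1 * t.2 ≠ 2 := by
  obtain ⟨p1, p2, h3, h4⟩ := ht
  intro h
  rw [h] at h3 h4
  nlinarith [mul_pos p1 p2]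

lemma isOpen_eulerDomain (x1 x2 : ℝ) : IsOpen (eulerDomain x1 x2) := by
  have key {f : ℝ × ℝ → ℝ} (hf : Continuous f) : IsOpen {t | 0 < f t} :=
    isOpen_lt continuous_const hf
  exact (key (f := fun t => t.1) (by fun_prop)).inter <|
    (key (f := fun t => t.2) (by fun_prop)).inter <|
    (key (f := fun t => 1 - t.1 + t.1 * t.2 * x2) (by fun_prop)).inter <|
    key (f := fun t => 1 - t.2 + t.1 * t.2 * x1) (by fun_prop)

lemma isOpen_eulerRegion (x1 x2 : ℝ) : IsOpen (eulerRegion x1 x2) :=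
  (isOpen_eulerDomain x1 x2).inter <|
    isOpen_lt (f := fun t : ℝ × ℝ => t.1 * t.2) (by fun_prop) continuous_const

lemma isBounded_eulerRegion (h1' : x1 < 1 / 16) (h2' : x2 < 1 / 16) :
    Bornology.IsBounded (eulerRegion x1 x2) := by
  refine (Metric.isBounded_Icc ((0, 0) : ℝ × ℝ) (9 / 8, 9 / 8)).subset fun t ht => ?_
  obtain ⟨h3, h4⟩ := lt_of_mem_eulerRegion h1' h2' ht
  exact ⟨⟨ht.1.1.le, ht.1.2.1.le⟩, ⟨h3.le, h4.le⟩⟩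

lemma box_subset_eulerRegion (h1 : 0 < x1) (h2 : 0 < x2) :
    Set.Ioo (0 : ℝ) 1 ×ˢ Set.Ioo (0 : ℝ) 1 ⊆ eulerRegion x1 x2 := by
  rintro ⟨s, t⟩ ⟨⟨hs, hs'⟩, ⟨ht, ht'⟩⟩
  have : 0 < s * t := mul_pos hs ht
  refine ⟨⟨hs, ht, ?_, ?_⟩, ?_⟩ <;> simp only at * <;> nlinarith

lemma smul_mem_eulerRegion (h1 : 0 < x1) (h1' : x1 < 1 / 16) (h2 : 0 < x2) (h2' : x2 < 1 / 16)
    {t : ℝ × ℝ} (ht : t ∈ eulerRegion x1 x2) {l : ℝ} (hl : 0 < l) (hl1 : l ≤ 1) :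
    l • t ∈ eulerRegion x1 x2 := by
  obtain ⟨b1, b2⟩ := lt_of_mem_eulerRegion h1' h2' ht
  obtain ⟨⟨p1, p2, h3, h4⟩, h5⟩ := ht
  obtain ⟨s, t⟩ := t
  simp only at *
  have hst := mul_pos p1 p2
  have aux {x s t : ℝ} (hx : 0 < x) (hx' : x < 1 / 16) (hs : 0 < s) (ht : 0 < t) (ht' : t < 9 / 8)
      (h : 0 < 1 - s + s * t * x) : 0 < 1 - l * s + l * s * (l * t) * x := by
    have e : 1 - l * s + l * s * (l * t) * x - (1 - s + s * t * x) =
      s * (1 - l) * (1 - t * x * (1 + l)) := by ring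
    have : 0 ≤ s * (1 - l) * (1 - t * x * (1 + l)) := by
      have : t * x ≤ 9 / 8 * (1 / 16) := by gcongr
      have : 0 < t * x := mul_pos ht hx
      exact mul_nonneg (mul_nonneg hs.le (by linarith)) (by nlinarith)
    linarith
  refine ⟨⟨mul_pos hl p1, mul_pos hl p2, aux h2 h2' p1 p2 b2 h3, ?_⟩, ?_⟩
  · have := aux h1 h1' p2 p1 b1 (by linarith [mul_comm s t])
    simp only [Prod.smul_mk, smul_eq_mul]
    linarith [mul_comm (l * s) (l * t)]
  · simp only [Prod.smul_mk, smul_eq_mul]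
    nlinarith [mul_pos hl hl]

lemma isPreconnected_eulerRegion (h1 : 0 < x1) (h1' : x1 < 1 / 16) (h2 : 0 < x2)
    (h2' : x2 < 1 / 16) : IsPreconnected (eulerRegion x1 x2) := by
  have hbox : Convex ℝ (Set.Ioo (0 : ℝ) 1 ×ˢ Set.Ioo (0 : ℝ) 1) :=
    (convex_Ioo 0 1).prod (convex_Ioo 0 1)
  have hhalf {t : ℝ × ℝ} (ht : t ∈ eulerRegion x1 x2) :
      (1 / 2 : ℝ) • t ∈ Set.Ioo (0 : ℝ) 1 ×ˢ Set.Ioo (0 : ℝ) 1 := by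
    obtain ⟨b1, b2⟩ := lt_of_mem_eulerRegion h1' h2' ht
    have := ht.1.1
    have := ht.1.2.1
    refine ⟨⟨?_, ?_⟩, ⟨?_, ?_⟩⟩ <;> simp only [Prod.smul_fst, Prod.smul_snd, smul_eq_mul] <;>
      linarith
  have hseg {t : ℝ × ℝ} (ht : t ∈ eulerRegion x1 x2) :
      JoinedIn (eulerRegion x1 x2) t ((1 / 2 : ℝ) • t) := by
    refine JoinedIn.of_segment_subset ?_
    rintro _ ⟨p, q, hp, hq, hpq, rfl⟩
    rw [smul_smul, ← add_smul]
    exact smul_mem_eulerRegion h1 h1' h2 h2' ht (by linarith) (by linarith)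
  refine IsPathConnected.isConnected ⟨(1 / 2, 1 / 2), ?_, ?_⟩ |>.isPreconnected
  · exact box_subset_eulerRegion h1 h2 (by norm_num)
  · intro t ht
    refine (hseg ht).trans (JoinedIn.of_segment_subset ?_) |>.symm
    exact (hbox.segment_subset (hhalf ht) (by norm_num)).trans (box_subset_eulerRegion h1 h2)

lemma connectedComponentIn_eulerDomain_of_mem (h1 : 0 < x1) (h1' : x1 < 1 / 16) (h2 : 0 < x2)
    (h2' : x2 < 1 / 16) {p : ℝ × ℝ} (hp : p ∈ eulerRegion x1 x2) :
    connectedComponentIn (eulerDomain x1 x2) p = eulerRegion x1 x2 := by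
  refine (Set.Subset.antisymm ?_ ?_)
  · have hsub : connectedComponentIn (eulerDomain x1 x2) p ⊆ {t : ℝ × ℝ | t.1 * t.2 < 2} := by
      refine isPreconnected_connectedComponentIn.subset_left_of_subset_union
        (v := {t : ℝ × ℝ | 2 < t.1 * t.2})
        (isOpen_lt (by fun_prop) continuous_const) (isOpen_lt continuous_const (by fun_prop)) ?_ ?_
        ⟨p, mem_connectedComponentIn hp.1, hp.2⟩
      · exact Set.disjoint_left.2 fun t (ht : t.1 * t.2 < 2) (ht' : 2 < t.1 * t.2) => lt_asymm ht ht'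
      · intro t ht
        exact lt_or_gt_of_ne (mul_ne_two_of_mem_eulerDomain h1 h1' h2'
          (connectedComponentIn_subset _ _ ht))
    exact fun t ht => ⟨connectedComponentIn_subset _ _ ht, hsub ht⟩
  · exact (isPreconnected_eulerRegion h1 h1' h2 h2').subset_connectedComponentIn hp fun t ht => ht.1

lemma not_isBounded_connectedComponentIn_eulerDomain (h1 : 0 < x1) (h1' : x1 < 1 / 16)
    (h2 : 0 < x2) (h2' : x2 < 1 / 16) {p : ℝ × ℝ} (hp : p ∈ eulerDomain x1 x2)
    (hp' : p ∉ eulerRegion x1 x2) :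
    ¬ Bornology.IsBounded (connectedComponentIn (eulerDomain x1 x2) p) := by
  obtain ⟨p1, p2, h3, h4⟩ := id hp
  set w0 := p.1 * p.2 with hw0
  have hw : 2 < w0 := lt_of_le_of_ne (not_lt.1 fun h => hp' ⟨hp, h⟩)
    (mul_ne_two_of_mem_eulerDomain h1 h1' h2' hp).symm
  have hx12 : 0 < x1 * x2 := mul_pos h1 h2
  have hσ : w0 < (1 + x2 * w0) * (1 + x1 * w0) := by
    calc w0 = p.1 * p.2 := hw0
      _ < _ := by gcongr <;> nlinarith
  have hw1 : 1 < 2 * (x1 * x2) * w0 := by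
    have : (1 + 2 * x1) * (1 + 2 * x2) < 2 := by nlinarith
    by_contra! h
    nlinarith
  set s := p.1 / (1 + x2 * w0) with hs
  have hd : 0 < 1 + x2 * w0 := by positivity
  have hs0 : 0 < s := by positivity
  have hs1 : s < 1 := by rw [hs, div_lt_one hd]; nlinarith
  set γ : ℝ → ℝ × ℝ := fun w => (s * (1 + x2 * w), w / (s * (1 + x2 * w))) with hγ
  have hden {w : ℝ} (hw' : w0 ≤ w) : 0 < s * (1 + x2 * w) := by
    have : 0 < w := by linarith
    positivity
  have hγ0 : γ w0 = p := by
    have e : s * (1 + x2 * w0) = p.1 := div_mul_cancel₀ _ hd.ne'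
    simp only [hγ, e]
    ext
    · rfl
    · simp only [hw0]
      field_simp
  have hmono {w : ℝ} (hw' : w0 ≤ w) : w * ((1 + x1 * w0) * (1 + x2 * w0)) ≤
      w0 * ((1 + x1 * w) * (1 + x2 * w)) := by
    have : 0 ≤ (w - w0) * (x1 * x2 * w * w0 - 1) := by
      refine mul_nonneg (by linarith) ?_
      have : x1 * x2 * w0 * 2 ≤ x1 * x2 * w * w0 := by
        have := mul_le_mul_of_nonneg_left (show w0 * 2 ≤ w * w0 by nlinarith) hx12.le
        linarith
      nlinarith
    nlinarith
  have hγU : γ '' Set.Ici w0 ⊆ eulerDomain x1 x2 := by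
    rintro _ ⟨w, hw', rfl⟩
    have hw' : w0 ≤ w := hw'
    have hd' := hden hw'
    have hwpos : 0 < w := by linarith
    have hprod : s * (1 + x2 * w) * (w / (s * (1 + x2 * w))) = w := by field_simp
    refine ⟨hd', by positivity, ?_, ?_⟩
    · simp only [hγ, hprod]
      nlinarith [mul_pos h2 hwpos]
    · simp only [hγ, hprod]
      have hkey : w0 < s * (1 + x2 * w0) * (1 + x1 * w0) := by
        rw [hs, div_mul_cancel₀ _ hd.ne']
        calc w0 = p.1 * p.2 := hw0
          _ < _ := by gcongr; nlinarith
      have : w < s * (1 + x2 * w) * (1 + x1 * w) := by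
        have a1 : w * w0 < w * (s * (1 + x2 * w0) * (1 + x1 * w0)) := by gcongr
        have a2 := mul_le_mul_of_nonneg_left (hmono hw') hs0.le
        nlinarith
      have : w / (s * (1 + x2 * w)) < 1 + x1 * w := by
        rw [div_lt_iff₀ hd']; linarith
      linarith
  have hγc : ContinuousOn γ (Set.Ici w0) := by
    refine ContinuousOn.prodMk (by fun_prop) (ContinuousOn.div (by fun_prop) (by fun_prop) ?_)
    exact fun w hw' => (hden hw').ne'
  have hsub : γ '' Set.Ici w0 ⊆ connectedComponentIn (eulerDomain x1 x2) p :=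
    (isPreconnected_Ici.image γ hγc).subset_connectedComponentIn
      ⟨w0, Set.self_mem_Ici, hγ0⟩ hγU
  intro hb
  obtain ⟨R, hR⟩ := (hb.subset hsub).subset_closedBall (0 : ℝ × ℝ)
  have hk : 0 < s * x2 := mul_pos hs0 h2
  set w := max w0 (R / (s * x2)) with hwdef
  have := hR ⟨w, Set.mem_Ici.2 (le_max_left _ _), rfl⟩
  rw [mem_closedBall_zero_iff] at this
  have h5 := (norm_fst_le (γ w)).trans this
  have h6 : R ≤ w * (s * x2) := (div_le_iff₀ hk).1 (le_max_right _ _)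
  have h7 := (le_abs_self _).trans h5
  simp only [hγ] at h7
  nlinarith

lemma isBddComponent_iff (h1 : 0 < x1) (h1' : x1 < 1 / 16) (h2 : 0 < x2) (h2' : x2 < 1 / 16)
    {D : Set (ℝ × ℝ)} : IsBddComponent x1 x2 D ↔ D = eulerRegion x1 x2 := by
  constructor
  · rintro ⟨⟨p, hp, rfl⟩, hb⟩
    by_cases hp' : p ∈ eulerRegion x1 x2
    · exact connectedComponentIn_eulerDomain_of_mem h1 h1' h2 h2' hp'
    · exact absurd hb (not_isBounded_connectedComponentIn_eulerDomain h1 h1' h2 h2' hp hp')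
  · rintro rfl
    have hp : ((1 / 2, 1 / 2) : ℝ × ℝ) ∈ eulerRegion x1 x2 :=
      box_subset_eulerRegion h1 h2 (by norm_num)
    exact ⟨⟨_, hp.1, (connectedComponentIn_eulerDomain_of_mem h1 h1' h2 h2' hp).symm⟩,
      isBounded_eulerRegion h1' h2'⟩

end Geometry

section Chart

/-- The chart mapping `eulerRegion x1 x2` onto the open unit square. -/
noncomputable def eulerChart (x1 x2 : ℝ) (t : ℝ × ℝ) : ℝ × ℝ :=
  (t.1 / (1 + x2 * (t.1 * t.2)), t.2 / (1 + x1 * (t.1 * t.2)))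

/-- The derivative of `eulerChart`, see `hasFDerivAt_eulerChart`. -/
noncomputable def fderivEulerChart (x1 x2 : ℝ) (t : ℝ × ℝ) : ℝ × ℝ →L[ℝ] ℝ × ℝ :=
  (Matrix.toLin (.finTwoProd ℝ) (.finTwoProd ℝ)
    !![1 / (1 + x2 * (t.1 * t.2)) ^ 2, -x2 * t.1 ^ 2 / (1 + x2 * (t.1 * t.2)) ^ 2;
      -x1 * t.2 ^ 2 / (1 + x1 * (t.1 * t.2)) ^ 2,
        1 / (1 + x1 * (t.1 * t.2)) ^ 2]).toContinuousLinearMap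

variable {x1 x2 : ℝ}

lemma hasFDerivAt_eulerChart {t : ℝ × ℝ} (hd1 : 1 + x1 * (t.1 * t.2) ≠ 0)
    (hd2 : 1 + x2 * (t.1 * t.2) ≠ 0) :
    HasFDerivAt (eulerChart x1 x2) (fderivEulerChart x1 x2 t) t := by
  unfold fderivEulerChart
  rw [Matrix.toLin_finTwoProd_toContinuousLinearMap]
  have hden (x : ℝ) := (((hasFDerivAt_fst (𝕜 := ℝ) (p := t)).mul
    (hasFDerivAt_snd (𝕜 := ℝ) (p := t))).const_mul x).const_add 1
  have hS1 := (hasFDerivAt_fst (𝕜 := ℝ) (p := t)).mul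
    ((hasDerivAt_inv hd2).comp_hasFDerivAt t (hden x2))
  have hS2 := (hasFDerivAt_snd (𝕜 := ℝ) (p := t)).mul
    ((hasDerivAt_inv hd1).comp_hasFDerivAt t (hden x1))
  refine (hS1.prodMk hS2).congr_fderiv ?_
  refine ContinuousLinearMap.ext fun v => Prod.ext ?_ ?_
  · simp
    field_simp
    ring
  · simp
    field_simp
    ring

lemma det_fderivEulerChart (t : ℝ × ℝ) :
    (fderivEulerChart x1 x2 t).det = (1 - x1 * x2 * (t.1 * t.2) ^ 2) /
      ((1 + x1 * (t.1 * t.2)) ^ 2 * (1 + x2 * (t.1 * t.2)) ^ 2) := by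
  rw [fderivEulerChart, ContinuousLinearMap.det, LinearMap.coe_toContinuousLinearMap,
    LinearMap.det_toLin, Matrix.det_fin_two_of]
  field_simp

/-- On the Euler region, the coordinates `s = eulerChart x1 x2 t` and `w = t₁t₂` satisfy
`t₁ = s₁(1 + x₂w)`, `t₂ = s₂(1 + x₁w)`. -/
lemma eulerChart_mul {t : ℝ × ℝ} (hd1 : 1 + x1 * (t.1 * t.2) ≠ 0)
    (hd2 : 1 + x2 * (t.1 * t.2) ≠ 0) :
    (eulerChart x1 x2 t).1 * (1 + x2 * (t.1 * t.2)) = t.1 ∧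
      (eulerChart x1 x2 t).2 * (1 + x1 * (t.1 * t.2)) = t.2 :=
  ⟨div_mul_cancel₀ _ hd2, div_mul_cancel₀ _ hd1⟩

lemma one_add_mul_pos_of_mem_eulerRegion (h1 : 0 < x1) (h2 : 0 < x2) {t : ℝ × ℝ}
    (ht : t ∈ eulerRegion x1 x2) : 0 < 1 + x1 * (t.1 * t.2) ∧ 0 < 1 + x2 * (t.1 * t.2) := by
  have := ht.1.1
  have := ht.1.2.1
  constructor <;> positivity

lemma eulerChart_mem (h1 : 0 < x1) (h2 : 0 < x2) {t : ℝ × ℝ} (ht : t ∈ eulerRegion x1 x2) :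
    eulerChart x1 x2 t ∈ Set.Ioo (0 : ℝ) 1 ×ˢ Set.Ioo (0 : ℝ) 1 := by
  obtain ⟨hd1, hd2⟩ := one_add_mul_pos_of_mem_eulerRegion h1 h2 ht
  obtain ⟨⟨p1, p2, h3, h4⟩, -⟩ := ht
  refine ⟨⟨div_pos p1 hd2, (div_lt_one hd2).2 (by linarith)⟩,
    ⟨div_pos p2 hd1, (div_lt_one hd1).2 (by linarith)⟩⟩

lemma injOn_eulerChart (h1 : 0 < x1) (h1' : x1 < 1 / 16) (h2 : 0 < x2) (h2' : x2 < 1 / 16) :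
    Set.InjOn (eulerChart x1 x2) (eulerRegion x1 x2) := by
  intro t ht t' ht' h
  obtain ⟨hd1, hd2⟩ := one_add_mul_pos_of_mem_eulerRegion h1 h2 ht
  obtain ⟨hd1', hd2'⟩ := one_add_mul_pos_of_mem_eulerRegion h1 h2 ht'
  obtain ⟨e1, e2⟩ := eulerChart_mul hd1.ne' hd2.ne'
  obtain ⟨e1', e2'⟩ := eulerChart_mul hd1'.ne' hd2'.ne'
  obtain ⟨⟨a1, b1⟩, ⟨a2, b2⟩⟩ := eulerChart_mem h1 h2 ht
  rw [← h] at e1' e2'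
  set s := eulerChart x1 x2 t
  set w := t.1 * t.2 with hw
  set w' := t'.1 * t'.2 with hw'
  have hs : 0 < s.1 * s.2 := mul_pos a1 a2
  have hs1 : s.1 * s.2 < 1 := by nlinarith
  have ew : w = s.1 * s.2 * ((1 + x1 * w) * (1 + x2 * w)) := by
    nth_rw 1 [hw]
    rw [← e1, ← e2]
    ring
  have ew' : w' = s.1 * s.2 * ((1 + x1 * w') * (1 + x2 * w')) := by
    nth_rw 1 [hw']
    rw [← e1', ← e2']
    ring
  have hpos : 0 < 1 - s.1 * s.2 * (x1 + x2 + x1 * x2 * (w + w')) := by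
    have hww : w + w' < 4 := by linarith [ht.2, ht'.2]
    have hww0 : 0 < w + w' :=
      add_pos (mul_pos ht.1.1 ht.1.2.1) (mul_pos ht'.1.1 ht'.1.2.1)
    have : x1 * x2 * (w + w') ≤ 1 / 16 * (1 / 16) * 4 := by gcongr
    have : 0 < x1 * x2 * (w + w') := by positivity
    nlinarith
  have key : (w - w') * (1 - s.1 * s.2 * (x1 + x2 + x1 * x2 * (w + w'))) = 0 := by
    linear_combination ew - ew'
  have hww : w = w' := sub_eq_zero.1 ((mul_eq_zero.1 key).resolve_right hpos.ne')
  rw [← hww] at e1' e2'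
  exact Prod.ext (e1.symm.trans e1') (e2.symm.trans e2')

lemma image_eulerChart (h1 : 0 < x1) (h1' : x1 < 1 / 16) (h2 : 0 < x2) (h2' : x2 < 1 / 16) :
    eulerChart x1 x2 '' eulerRegion x1 x2 = Set.Ioo (0 : ℝ) 1 ×ˢ Set.Ioo (0 : ℝ) 1 := by
  refine Set.Subset.antisymm (Set.image_subset_iff.2 fun t ht => eulerChart_mem h1 h2 ht) ?_
  rintro ⟨s1, s2⟩ ⟨⟨a1, b1⟩, ⟨a2, b2⟩⟩
  simp only at a1 b1 a2 b2
  have hs : 0 < s1 * s2 := mul_pos a1 a2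
  have hs1 : s1 * s2 < 1 := by nlinarith
  obtain ⟨w, ⟨hw0, hw2⟩, hw⟩ := intermediate_value_Ioo (zero_le_two (α := ℝ))
    (f := fun w => w - s1 * s2 * ((1 + x1 * w) * (1 + x2 * w))) (by fun_prop)
    (show (0 : ℝ) ∈ _ by
      have : (1 + x1 * 2) * (1 + x2 * 2) < 2 := by nlinarith
      constructor
      · simpa using hs
      · nlinarith)
  have ew : s1 * (1 + x2 * w) * (s2 * (1 + x1 * w)) = w := by linear_combination -hw
  have hd1 : 0 < 1 + x1 * w := by positivity
  have hd2 : 0 < 1 + x2 * w := by positivity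
  refine ⟨(s1 * (1 + x2 * w), s2 * (1 + x1 * w)), ⟨⟨by positivity, by positivity, ?_, ?_⟩, ?_⟩, ?_⟩
  · simp only [ew]
    nlinarith
  · simp only [ew]
    nlinarith
  · simpa only [ew] using hw2
  · simp only [eulerChart, ew]
    rw [mul_div_cancel_right₀ _ hd2.ne', mul_div_cancel_right₀ _ hd1.ne']

end Chart

/-- The generating function of `appellCoeff`, restricted to the ray through `(x1, x2)`. -/
noncomputable def appellGenerating (c1 c2 : ℂ) (x1 x2 σ : ℝ) : ℂ :=
  ∑' n : ℕ × ℕ, appellCoeff c1 c2 n * (((σ * x1 : ℝ) : ℂ) ^ n.1 * ((σ * x2 : ℝ) : ℂ) ^ n.2)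

/-- The integrand of the beta integral `B(u, v)`. -/
noncomputable def betaIntegrand (u v : ℂ) (s : ℝ) : ℂ :=
  (s : ℂ) ^ (u - 1) * (1 - s : ℂ) ^ (v - 1)

section Pullback

variable {x1 x2 : ℝ}

lemma appellGenerating_eq (c1 c2 : ℂ) (h1 : 0 < x1) (h1' : x1 < 1 / 16) (h2 : 0 < x2)
    (h2' : x2 < 1 / 16) {t : ℝ × ℝ} (ht : t ∈ eulerRegion x1 x2) :
    appellGenerating c1 c2 x1 x2 ((eulerChart x1 x2 t).1 * (eulerChart x1 x2 t).2) =
      ((1 + x2 * (t.1 * t.2) : ℝ) : ℂ) ^ c1 * ((1 + x1 * (t.1 * t.2) : ℝ) : ℂ) ^ c2 /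
        ((1 - x1 * x2 * (t.1 * t.2) ^ 2 : ℝ) : ℂ) := by
  obtain ⟨hd1, hd2⟩ := one_add_mul_pos_of_mem_eulerRegion h1 h2 ht
  obtain ⟨e1, e2⟩ := eulerChart_mul hd1.ne' hd2.ne'
  obtain ⟨⟨a1, b1⟩, ⟨a2, b2⟩⟩ := eulerChart_mem h1 h2 ht
  set s := eulerChart x1 x2 t
  have hw0 : 0 < t.1 * t.2 := mul_pos ht.1.1 ht.1.2.1
  have hw2 : t.1 * t.2 < 2 := ht.2
  have ew : t.1 * t.2 = s.1 * s.2 * ((1 + x1 * (t.1 * t.2)) * (1 + x2 * (t.1 * t.2))) := by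
    linear_combination -e1 * t.2 - s.1 * (1 + x2 * (t.1 * t.2)) * e2
  set w := t.1 * t.2
  have hs : 0 < s.1 * s.2 := mul_pos a1 a2
  have hs1 : s.1 * s.2 < 1 := by nlinarith
  have ev (x : ℝ) : s.1 * s.2 * x * ((1 + x1 * w) * (1 + x2 * w)) = x * w := by
    linear_combination -x * ew
  have hy {x : ℝ} (hx : 0 < x) (hx' : x < 1 / 16) : ‖((s.1 * s.2 * x : ℝ) : ℂ)‖ ≤ 1 / 16 := by
    rw [Complex.norm_real, Real.norm_of_nonneg (by positivity)]
    nlinarith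
  have hv : ‖(((1 + x1 * w) * (1 + x2 * w) : ℝ) : ℂ)‖ < 2 := by
    rw [Complex.norm_real, Real.norm_of_nonneg (by positivity)]
    have : x1 * w ≤ 1 / 16 * 2 := by gcongr
    have : x2 * w ≤ 1 / 16 * 2 := by gcongr
    nlinarith
  have hsum := (hasSum_appellCoeff c1 c2 (hy h1 h1') (hy h2 h2') hv (by
    rw [← Complex.ofReal_mul, ← Complex.ofReal_mul, ev, ev]
    push_cast
    ring)).tsum_eq
  rw [appellGenerating, hsum, ← Complex.ofReal_mul, ← Complex.ofReal_mul, ev, ev]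
  have e3 : s.1 * s.2 * x1 * (s.1 * s.2 * x2) * ((1 + x1 * w) * (1 + x2 * w)) ^ 2 =
      x1 * x2 * w ^ 2 := by
    linear_combination x2 * w * ev x1 + s.1 * s.2 * x1 * ((1 + x1 * w) * (1 + x2 * w)) * ev x2
  rw [← e3]
  push_cast
  rfl

lemma det_smul_eq_eulerIntegrand (a b c1 c2 : ℂ) (h1 : 0 < x1) (h1' : x1 < 1 / 16) (h2 : 0 < x2)
    (h2' : x2 < 1 / 16) {t : ℝ × ℝ} (ht : t ∈ eulerRegion x1 x2) :
    |(fderivEulerChart x1 x2 t).det| •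
      (betaIntegrand a (c1 - a) (eulerChart x1 x2 t).1 *
        betaIntegrand b (c2 - b) (eulerChart x1 x2 t).2 *
        appellGenerating c1 c2 x1 x2 ((eulerChart x1 x2 t).1 * (eulerChart x1 x2 t).2)) =
      eulerIntegrand a b c1 c2 x1 x2 t := by
  rw [appellGenerating_eq c1 c2 h1 h1' h2 h2' ht]
  obtain ⟨hd1, hd2⟩ := one_add_mul_pos_of_mem_eulerRegion h1 h2 ht
  rw [det_fderivEulerChart]
  obtain ⟨e1, e2⟩ := eulerChart_mul hd1.ne' hd2.ne'
  obtain ⟨⟨a1, b1⟩, ⟨a2, b2⟩⟩ := eulerChart_mem h1 h2 ht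
  set s := eulerChart x1 x2 t
  have hw0 : 0 < t.1 * t.2 := mul_pos ht.1.1 ht.1.2.1
  have hw2 : t.1 * t.2 < 2 := ht.2
  set w := t.1 * t.2 with hw
  have hJ : 0 < 1 - x1 * x2 * w ^ 2 := by
    have : x1 * x2 * w ^ 2 ≤ 1 / 16 * (1 / 16) * 2 ^ 2 := by gcongr
    linarith
  have e3 : 1 - t.1 + w * x2 = (1 - s.1) * (1 + x2 * w) := by linear_combination e1
  have e4 : 1 - t.2 + w * x1 = (1 - s.2) * (1 + x1 * w) := by linear_combination e2
  have hsplit {p q : ℝ} (hp : 0 < p) (hq : 0 < q) (r : ℂ) :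
      ((p * q : ℝ) : ℂ) ^ r = (p : ℂ) ^ r * (q : ℂ) ^ r := by
    rw [Complex.ofReal_mul, Complex.mul_cpow_ofReal_nonneg hp.le hq.le]
  have hI : eulerIntegrand a b c1 c2 x1 x2 t =
      ((s.1 * (1 + x2 * w) : ℝ) : ℂ) ^ (a - 1) * ((s.2 * (1 + x1 * w) : ℝ) : ℂ) ^ (b - 1) *
      (((1 - s.1) * (1 + x2 * w) : ℝ) : ℂ) ^ (c1 - a - 1) *
      (((1 - s.2) * (1 + x1 * w) : ℝ) : ℂ) ^ (c2 - b - 1) := by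
    rw [e1, e2, ← e3, ← e4, hw, eulerIntegrand]
  rw [hI, hsplit a1 hd2, hsplit a2 hd1, hsplit (sub_pos.2 b1) hd2, hsplit (sub_pos.2 b2) hd1,
    abs_of_pos (by positivity), Complex.real_smul, betaIntegrand, betaIntegrand]
  have hA : ((1 + x2 * w : ℝ) : ℂ) ≠ 0 := by exact_mod_cast hd2.ne'
  have hB : ((1 + x1 * w : ℝ) : ℂ) ≠ 0 := by exact_mod_cast hd1.ne'
  have hJ' : ((1 - x1 * x2 * w ^ 2 : ℝ) : ℂ) ≠ 0 := by exact_mod_cast hJ.ne'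
  have hpow {z : ℂ} (hz : z ≠ 0) (u c : ℂ) : z ^ c = z ^ (u - 1) * z ^ (c - u - 1) * z ^ 2 := by
    rw [← Complex.cpow_add _ _ hz, ← Complex.cpow_natCast, ← Complex.cpow_add _ _ hz]
    congr 1
    push_cast
    ring
  rw [hpow hA a c1, hpow hB b c2]
  generalize ((1 + x2 * w : ℝ) : ℂ) ^ (a - 1) = A1
  simp only [Complex.ofReal_div, Complex.ofReal_mul (_ ^ 2), Complex.ofReal_pow (1 + _),
    Complex.ofReal_sub 1 s.1, Complex.ofReal_sub 1 s.2, Complex.ofReal_one]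
  field_simp

end Pullback

section BetaIntegral

lemma betaIntegrand_add_natCast (u v : ℂ) (N : ℕ) {s : ℝ} (hs : 0 < s) :
    betaIntegrand (u + N) v s = (s : ℂ) ^ N * betaIntegrand u v s := by
  have hs' : (s : ℂ) ≠ 0 := by exact_mod_cast hs.ne'
  rw [betaIntegrand, betaIntegrand, ← Complex.cpow_natCast, ← mul_assoc,
    ← Complex.cpow_add _ _ hs']
  congr 2
  ring

lemma integrableOn_betaIntegrand {u v : ℂ} (hu : 0 < u.re) (hv : 0 < v.re) :
    IntegrableOn (betaIntegrand u v) (Set.Ioo 0 1) :=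
  (intervalIntegrable_iff_integrableOn_Ioo_of_le zero_le_one).1
    (Complex.betaIntegral_convergent hu hv)

lemma setIntegral_betaIntegrand (u v : ℂ) :
    ∫ s in Set.Ioo (0 : ℝ) 1, betaIntegrand u v s = Complex.betaIntegral u v := by
  rw [Complex.betaIntegral, intervalIntegral.integral_of_le zero_le_one,
    integral_Ioc_eq_integral_Ioo]
  rfl

lemma Gamma_div_mul_betaIntegral {a c : ℂ} (ha : 0 < a.re) (hac : a.re < c.re) (N : ℕ) :
    Complex.Gamma c / (Complex.Gamma a * Complex.Gamma (c - a)) *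
      Complex.betaIntegral (a + N) (c - a) =
      (ascPochhammer ℂ N).eval a / (ascPochhammer ℂ N).eval c := by
  have hne {z : ℂ} (hz : 0 < z.re) (k : ℕ) : z ≠ -k := by
    rintro rfl
    simp at hz
    linarith [k.cast_nonneg (α := ℝ)]
  have hc : 0 < c.re := ha.trans hac
  have hca : 0 < (c - a).re := by simpa using hac
  have haN : 0 < (a + N).re := by simpa using add_pos_of_pos_of_nonneg ha N.cast_nonneg
  have hcN : 0 < (c + N).re := by simpa using add_pos_of_pos_of_nonneg hc N.cast_nonneg
  have h := Complex.Gamma_mul_Gamma_eq_betaIntegral haN hca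
  rw [show a + N + (c - a) = c + N by ring] at h
  have g1 := Complex.Gamma_ne_zero_of_re_pos ha
  have g2 := Complex.Gamma_ne_zero_of_re_pos hc
  have g3 := Complex.Gamma_ne_zero_of_re_pos hca
  have g4 := Complex.Gamma_ne_zero_of_re_pos hcN
  rw [← Complex.Gamma_add_nat_div_Gamma_eq a (hne ha),
    ← Complex.Gamma_add_nat_div_Gamma_eq c (hne hc)]
  field_simp
  linear_combination -h

lemma ascPochhammer_eval_ne_zero_of_re_pos {c : ℂ} (hc : 0 < c.re) (n : ℕ) :
    (ascPochhammer ℂ n).eval c ≠ 0 := by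
  rw [Ne, ascPochhammer_eval_eq_zero_iff]
  rintro ⟨k, -, hk⟩
  have := congrArg Complex.re hk
  simp at this
  linarith [k.cast_nonneg (α := ℝ)]

lemma ascPochhammer_eval_add (c : ℂ) (n m : ℕ) :
    (ascPochhammer ℂ (n + m)).eval c =
      (ascPochhammer ℂ n).eval c * (ascPochhammer ℂ m).eval (c + n) := by
  rw [← ascPochhammer_mul]
  simp

end BetaIntegral

section Square

variable {a b c1 c2 : ℂ} {x1 x2 : ℝ}

lemma appellTerm_eq (c1 c2 u v : ℂ) (x1 x2 : ℝ) (n : ℕ × ℕ) {s : ℝ × ℝ}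
    (hs : s ∈ Set.Ioo (0 : ℝ) 1 ×ˢ Set.Ioo (0 : ℝ) 1) :
    betaIntegrand a u s.1 * betaIntegrand b v s.2 * (appellCoeff c1 c2 n *
        (((s.1 * s.2 * x1 : ℝ) : ℂ) ^ n.1 * ((s.1 * s.2 * x2 : ℝ) : ℂ) ^ n.2)) =
      appellCoeff c1 c2 n * ((x1 : ℂ) ^ n.1 * (x2 : ℂ) ^ n.2) *
        (betaIntegrand (a + (n.1 + n.2 : ℕ)) u s.1 *
          betaIntegrand (b + (n.1 + n.2 : ℕ)) v s.2) := by
  rw [betaIntegrand_add_natCast _ _ _ hs.1.1, betaIntegrand_add_natCast _ _ _ hs.2.1]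
  push_cast
  ring

lemma norm_appellTerm_le (c1 c2 : ℂ) (h1 : 0 < x1) (h2 : 0 < x2) (n : ℕ × ℕ) {s : ℝ × ℝ}
    (hs : s ∈ Set.Ioo (0 : ℝ) 1 ×ˢ Set.Ioo (0 : ℝ) 1) :
    ‖appellCoeff c1 c2 n *
        (((s.1 * s.2 * x1 : ℝ) : ℂ) ^ n.1 * ((s.1 * s.2 * x2 : ℝ) : ℂ) ^ n.2)‖ ≤
      ‖appellCoeff c1 c2 n‖ * (x1 ^ n.1 * x2 ^ n.2) := by
  obtain ⟨⟨a1, b1⟩, ⟨a2, b2⟩⟩ := hs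
  have hσ : 0 < s.1 * s.2 := mul_pos a1 a2
  have hσ1 : s.1 * s.2 ≤ 1 := by nlinarith
  have hle {x : ℝ} (hx : 0 < x) : ‖((s.1 * s.2 * x : ℝ) : ℂ)‖ ≤ x := by
    rw [Complex.norm_real, Real.norm_of_nonneg (by positivity)]
    exact mul_le_of_le_one_left hx.le hσ1
  rw [norm_mul, norm_mul, norm_pow, norm_pow]
  gcongr
  · exact hle h1
  · exact hle h2

lemma integrableOn_betaIntegrand_mul {a b u v : ℂ} (ha : 0 < a.re) (hu : 0 < u.re)
    (hb : 0 < b.re) (hv : 0 < v.re) :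
    IntegrableOn (fun s : ℝ × ℝ => betaIntegrand a u s.1 * betaIntegrand b v s.2)
      (Set.Ioo (0 : ℝ) 1 ×ˢ Set.Ioo (0 : ℝ) 1) := by
  rw [IntegrableOn, Measure.volume_eq_prod, ← Measure.prod_restrict]
  exact (integrableOn_betaIntegrand ha hu).mul_prod (integrableOn_betaIntegrand hb hv)

lemma integrableOn_betaIntegrand_mul_appellGenerating (ha : 0 < a.re) (hac : a.re < c1.re)
    (hb : 0 < b.re) (hbc : b.re < c2.re) (h1 : 0 < x1) (h1' : x1 < 1 / 16) (h2 : 0 < x2)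
    (h2' : x2 < 1 / 16) :
    IntegrableOn (fun s : ℝ × ℝ => betaIntegrand a (c1 - a) s.1 * betaIntegrand b (c2 - b) s.2 *
      appellGenerating c1 c2 x1 x2 (s.1 * s.2)) (Set.Ioo (0 : ℝ) 1 ×ˢ Set.Ioo (0 : ℝ) 1) := by
  have hQ : MeasurableSet (Set.Ioo (0 : ℝ) 1 ×ˢ Set.Ioo (0 : ℝ) 1) :=
    measurableSet_Ioo.prod measurableSet_Ioo
  have hsum := summable_norm_appellCoeff c1 c2 h1.le (by linarith) h2.le (by linarith)
  refine Integrable.mul_bdd (c := ∑' n : ℕ × ℕ, ‖appellCoeff c1 c2 n‖ * (x1 ^ n.1 * x2 ^ n.2))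
    (integrableOn_betaIntegrand_mul ha (by simpa using hac) hb (by simpa using hbc)) ?_ ?_
  · refine ContinuousOn.aestronglyMeasurable ?_ hQ
    exact continuousOn_tsum (fun n => by fun_prop) hsum
      fun n s hs => norm_appellTerm_le c1 c2 h1 h2 n hs
  · refine (ae_restrict_iff' hQ).2 (ae_of_all _ fun s hs => ?_)
    exact tsum_of_norm_bounded hsum.hasSum fun n => norm_appellTerm_le c1 c2 h1 h2 n hs

lemma hasSum_setIntegral_appellGenerating (ha : 0 < a.re) (hac : a.re < c1.re)
    (hb : 0 < b.re) (hbc : b.re < c2.re) (h1 : 0 < x1) (h1' : x1 < 1 / 16) (h2 : 0 < x2)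
    (h2' : x2 < 1 / 16) :
    HasSum (fun n : ℕ × ℕ => appellCoeff c1 c2 n * ((x1 : ℂ) ^ n.1 * (x2 : ℂ) ^ n.2) *
        (Complex.betaIntegral (a + (n.1 + n.2 : ℕ)) (c1 - a) *
          Complex.betaIntegral (b + (n.1 + n.2 : ℕ)) (c2 - b)))
      (∫ s in Set.Ioo (0 : ℝ) 1 ×ˢ Set.Ioo (0 : ℝ) 1,
        betaIntegrand a (c1 - a) s.1 * betaIntegrand b (c2 - b) s.2 *
          appellGenerating c1 c2 x1 x2 (s.1 * s.2)) := by
  set Q := Set.Ioo (0 : ℝ) 1 ×ˢ Set.Ioo (0 : ℝ) 1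
  have hQ : MeasurableSet Q := measurableSet_Ioo.prod measurableSet_Ioo
  have hca : 0 < (c1 - a).re := by simpa using hac
  have hcb : 0 < (c2 - b).re := by simpa using hbc
  set F : ℕ × ℕ → ℝ × ℝ → ℂ := fun n s =>
    betaIntegrand a (c1 - a) s.1 * betaIntegrand b (c2 - b) s.2 * (appellCoeff c1 c2 n *
      (((s.1 * s.2 * x1 : ℝ) : ℂ) ^ n.1 * ((s.1 * s.2 * x2 : ℝ) : ℂ) ^ n.2)) with hF
  have hf := integrableOn_betaIntegrand_mul ha hca hb hcb
  have hre {z : ℂ} (hz : 0 < z.re) (N : ℕ) : 0 < (z + N).re := by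
    simpa using add_pos_of_pos_of_nonneg hz N.cast_nonneg
  have hint (n : ℕ × ℕ) : IntegrableOn (F n) Q :=
    IntegrableOn.congr_fun
      ((integrableOn_betaIntegrand_mul (hre ha _) hca (hre hb _) hcb).const_mul _)
      (fun s hs => (appellTerm_eq c1 c2 _ _ x1 x2 n hs).symm) hQ
  have hsum := summable_norm_appellCoeff c1 c2 h1.le (by linarith) h2.le (by linarith)
  have key := hasSum_integral_of_summable_integral_norm hint (by
    refine Summable.of_nonneg_of_le (fun n => integral_nonneg fun s => norm_nonneg _)
      (fun n => ?_) (hsum.mul_left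
        (∫ s in Q, ‖betaIntegrand a (c1 - a) s.1 * betaIntegrand b (c2 - b) s.2‖))
    rw [← integral_mul_const]
    refine setIntegral_mono_on (hint n).norm (hf.norm.mul_const _) hQ fun s hs => ?_
    rw [hF, norm_mul]
    gcongr
    exact norm_appellTerm_le c1 c2 h1 h2 n hs)
  simp only [hF, tsum_mul_left] at key
  convert! key using 2 with n
  rw [setIntegral_congr_fun hQ fun s hs => appellTerm_eq c1 c2 _ _ x1 x2 n hs, integral_const_mul,
    Measure.volume_eq_prod, setIntegral_prod_mul, setIntegral_betaIntegrand,
    setIntegral_betaIntegrand]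

lemma Gamma_mul_setIntegral_eq_appellF4 (ha : 0 < a.re) (hac : a.re < c1.re)
    (hb : 0 < b.re) (hbc : b.re < c2.re) (h1 : 0 < x1) (h1' : x1 < 1 / 16) (h2 : 0 < x2)
    (h2' : x2 < 1 / 16) :
    (Complex.Gamma c1 * Complex.Gamma c2 /
        (Complex.Gamma a * Complex.Gamma b * Complex.Gamma (c1 - a) * Complex.Gamma (c2 - b))) *
      (∫ s in Set.Ioo (0 : ℝ) 1 ×ˢ Set.Ioo (0 : ℝ) 1,
        betaIntegrand a (c1 - a) s.1 * betaIntegrand b (c2 - b) s.2 *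
          appellGenerating c1 c2 x1 x2 (s.1 * s.2)) =
      appellF4 a b c1 c2 ((x1 : ℂ), (x2 : ℂ)) := by
  rw [← ((hasSum_setIntegral_appellGenerating ha hac hb hbc h1 h1' h2 h2').mul_left _).tsum_eq,
    appellF4]
  refine tsum_congr fun n => ?_
  have e1 := Gamma_div_mul_betaIntegral ha hac (n.1 + n.2)
  have e2 := Gamma_div_mul_betaIntegral hb hbc (n.1 + n.2)
  rw [ascPochhammer_eval_add c1] at e1
  rw [add_comm n.1 n.2, ascPochhammer_eval_add c2, add_comm n.2 n.1] at e2
  have p1 := ascPochhammer_eval_ne_zero_of_re_pos (ha.trans hac) n.1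
  have p2 := ascPochhammer_eval_ne_zero_of_re_pos (hb.trans hbc) n.2
  have p3 := ascPochhammer_eval_ne_zero_of_re_pos
    (show 0 < (c1 + n.1).re by simpa using add_pos_of_pos_of_nonneg (ha.trans hac) n.1.cast_nonneg)
    n.2
  have p4 := ascPochhammer_eval_ne_zero_of_re_pos
    (show 0 < (c2 + n.2).re by simpa using add_pos_of_pos_of_nonneg (hb.trans hbc) n.2.cast_nonneg)
    n.1
  have f1 : (n.1.factorial : ℂ) ≠ 0 := by exact_mod_cast n.1.factorial_ne_zero
  have f2 : (n.2.factorial : ℂ) ≠ 0 := by exact_mod_cast n.2.factorial_ne_zero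
  calc _ = appellCoeff c1 c2 n * ((x1 : ℂ) ^ n.1 * (x2 : ℂ) ^ n.2) *
        (Complex.Gamma c1 / (Complex.Gamma a * Complex.Gamma (c1 - a)) *
            Complex.betaIntegral (a + (n.1 + n.2 : ℕ)) (c1 - a) *
          (Complex.Gamma c2 / (Complex.Gamma b * Complex.Gamma (c2 - b)) *
            Complex.betaIntegral (b + (n.1 + n.2 : ℕ)) (c2 - b))) := by
        ring
    _ = _ := by
        rw [e1, e2, appellCoeff]
        field_simp

end Square

/-- Euler-type integral representation of Appell's `F₄`: for `Re c₁ > Re a > 0` and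
`Re c₂ > Re b > 0` and sufficiently small positive real `x₁, x₂`, the domain `U` has a
unique bounded connected component `D`, the integrand is integrable on `D`, and the
integral over `D` represents `F₄(a,b,c₁,c₂;(x₁,x₂))`. -/
theorem appellF4_euler_integral_rep (a b c1 c2 : ℂ)
    (ha : 0 < a.re) (hac : a.re < c1.re) (hb : 0 < b.re) (hbc : b.re < c2.re) :
    ∃ ε > (0 : ℝ), ∀ x1 x2 : ℝ, 0 < x1 → x1 < ε → 0 < x2 → x2 < ε →
      (∃! D : Set (ℝ × ℝ), IsBddComponent x1 x2 D) ∧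
      ∀ D : Set (ℝ × ℝ), IsBddComponent x1 x2 D →
        IntegrableOn (eulerIntegrand a b c1 c2 x1 x2) D volume ∧
        (Complex.Gamma c1 * Complex.Gamma c2 /
            (Complex.Gamma a * Complex.Gamma b * Complex.Gamma (c1 - a) *
              Complex.Gamma (c2 - b))) *
          (∫ t in D, eulerIntegrand a b c1 c2 x1 x2 t ∂volume) =
          appellF4 a b c1 c2 ((x1 : ℂ), (x2 : ℂ)) := by
  refine ⟨1 / 16, by norm_num, fun x1 x2 h1 h1' h2 h2' => ?_⟩
  have hD {D : Set (ℝ × ℝ)} : IsBddComponent x1 x2 D ↔ D = eulerRegion x1 x2 :=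
    isBddComponent_iff h1 h1' h2 h2'
  refine ⟨⟨eulerRegion x1 x2, hD.2 rfl, fun D h => hD.1 h⟩, fun D h => ?_⟩
  obtain rfl := hD.1 h
  have hmeas := (isOpen_eulerRegion x1 x2).measurableSet
  have hderiv : ∀ t ∈ eulerRegion x1 x2,
      HasFDerivWithinAt (eulerChart x1 x2) (fderivEulerChart x1 x2 t) (eulerRegion x1 x2) t := by
    intro t ht
    obtain ⟨hd1, hd2⟩ := one_add_mul_pos_of_mem_eulerRegion h1 h2 ht
    exact (hasFDerivAt_eulerChart hd1.ne' hd2.ne').hasFDerivWithinAt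
  have hinj := injOn_eulerChart h1 h1' h2 h2'
  have hcongr : Set.EqOn _ (eulerIntegrand a b c1 c2 x1 x2) (eulerRegion x1 x2) := fun t ht =>
    det_smul_eq_eulerIntegrand a b c1 c2 h1 h1' h2 h2' ht
  constructor
  · refine IntegrableOn.congr_fun ?_ hcongr hmeas
    rw [← integrableOn_image_iff_integrableOn_abs_det_fderiv_smul volume hmeas hderiv hinj
      (fun s : ℝ × ℝ => betaIntegrand a (c1 - a) s.1 * betaIntegrand b (c2 - b) s.2 *
        appellGenerating c1 c2 x1 x2 (s.1 * s.2)), image_eulerChart h1 h1' h2 h2']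
    exact integrableOn_betaIntegrand_mul_appellGenerating ha hac hb hbc h1 h1' h2 h2'
  · rw [← setIntegral_congr_fun hmeas hcongr,
      ← integral_image_eq_integral_abs_det_fderiv_smul volume hmeas hderiv hinj
      (fun s : ℝ × ℝ => betaIntegrand a (c1 - a) s.1 * betaIntegrand b (c2 - b) s.2 *
        appellGenerating c1 c2 x1 x2 (s.1 * s.2)), image_eulerChart h1 h1' h2 h2']
    exact Gamma_mul_setIntegral_eq_appellF4 ha hac hb hbc h1 h1' h2 h2'
end

section
/- Let α, β, γ1, γ2 be nonzero complex numbers with α ≠ 1, β ≠ 1, α ≠ γ1, α ≠ γ2, α ≠ γ1γ2, β ≠ γ1, β ≠ γ2, γ1 ≠ 1, and γ2 ≠ 1, and let Ĥ be the matrix defined in the context. Let Ĥ13 be the 2×2 matrix with entries Ĥ[1,1], Ĥ[1,3], Ĥ[3,1], Ĥ[3,3]. Then Ĥ13 is invertible with inverse ((α−γ1γ2)(1−β)/(αβ(1−γ1)γ2²)) · [[(αβ−γ2)γ2, (α−γ2)(β−γ2)], [−(α−γ2)(β−γ2)γ2, −(α−γ2)(β−γ2)(1−γ2)]], and (1/γ1)·I₄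 + (1 − 1/γ1)·Ĥ·(e1ᵀ, e3ᵀ)·(Ĥ13)⁻¹·(e1; e3) = [[1,0,0,0],[1, 1/γ1, 0, 0],[0,0,1,0],[(αβ−γ2)/(αβ), 0, (α−γ2)(β−γ2)/(αβγ2), 1/γ1]], where (e1ᵀ, e3ᵀ) is the 4×2 matrix with columns e1ᵀ, e3ᵀ and (e1; e3) is the 2×4 matrix with rows e1, e3. -/
open Matrix

/-- The intersection matrix `Ĥ` of the twisted cycles `Δ̂₁,…,Δ̂₄` for Appell's
system `𝓕₄`. -/
noncomputable def Hhat (α β γ1 γ2 : ℂ) : Matrix (Fin 4) (Fin 4) ℂ :=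
  !![-(α*β*(1-γ1)*(1-γ2)) / ((1-α)*(α-γ1*γ2)*(1-β)^2),
     -(α*β*(1-γ2)) / ((1-α)*(α-γ1*γ2)*(1-β)^2),
     -(α*β*(1-γ1)) / ((1-α)*(α-γ1*γ2)*(1-β)^2),
     -(α*β) / ((α-γ1*γ2)*(1-β));
     α*β*γ1*(1-γ2) / ((1-α)*(α-γ1*γ2)*(1-β)^2),
     α*β*(α*β-γ1)*γ1*(1-γ2) / ((1-α)*(α-γ1)*(α-γ1*γ2)*(1-β)^2*(β-γ1)),
     α*β*γ1 / ((1-α)*(α-γ1*γ2)*(1-β)^2),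
     0;
     α*β*(1-γ1)*γ2 / ((1-α)*(α-γ1*γ2)*(1-β)^2),
     α*β*γ2 / ((1-α)*(α-γ1*γ2)*(1-β)^2),
     α*β*(α*β-γ2)*(1-γ1)*γ2 / ((1-α)*(α-γ2)*(α-γ1*γ2)*(1-β)^2*(β-γ2)),
     0;
     -(γ1*γ2) / ((α-γ1*γ2)*(1-β)),
     0,
     0,
     -(α*β+γ1*γ2) / ((α-γ1*γ2)*(1-β))]

/-- The representation matrix `M₁` of the circuit transform `𝓜₁` of Appell's system
`𝓕₄` (Corollary 4.4), together with the explicit inverse of the submatrix `Ĥ₁₃`. -/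
theorem circuit_matrix_M1 (α β γ1 γ2 : ℂ)
    (hα : α ≠ 0) (hβ : β ≠ 0) (hγ1 : γ1 ≠ 0) (hγ2 : γ2 ≠ 0)
    (hα1 : α ≠ 1) (hβ1 : β ≠ 1) (hαγ1 : α ≠ γ1) (hαγ2 : α ≠ γ2)
    (hαγ12 : α ≠ γ1 * γ2) (hβγ1 : β ≠ γ1) (hβγ2 : β ≠ γ2)
    (hγ1ne : γ1 ≠ 1) (hγ2ne : γ2 ≠ 1)
    (H13 : Matrix (Fin 2) (Fin 2) ℂ)
    (hH13 : H13 = !![Hhat α β γ1 γ2 0 0, Hhat α β γ1 γ2 0 2;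
                     Hhat α β γ1 γ2 2 0, Hhat α β γ1 γ2 2 2])
    (H13inv : Matrix (Fin 2) (Fin 2) ℂ)
    (hH13inv : H13inv = ((α-γ1*γ2)*(1-β) / (α*β*(1-γ1)*γ2^2)) •
      !![(α*β-γ2)*γ2, (α-γ2)*(β-γ2);
         -((α-γ2)*(β-γ2)*γ2), -((α-γ2)*(β-γ2)*(1-γ2))]) :
    H13 * H13inv = 1 ∧ H13inv * H13 = 1 ∧
      (1/γ1) • (1 : Matrix (Fin 4) (Fin 4) ℂ) +
        (1 - 1/γ1) • (Hhat α β γ1 γ2 * (!![1,0; 0,0; 0,1; 0,0] : Matrix (Fin 4) (Fin 2) ℂ) *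
          H13inv * (!![1,0,0,0; 0,0,1,0] : Matrix (Fin 2) (Fin 4) ℂ)) =
      !![1, 0, 0, 0;
         1, 1/γ1, 0, 0;
         0, 0, 1, 0;
         (α*β-γ2)/(α*β), 0, (α-γ2)*(β-γ2)/(α*β*γ2), 1/γ1] := by
  have h1 : (1 - α) ≠ 0 := sub_ne_zero.mpr hα1.symm
  have h2 : (1 - β) ≠ 0 := sub_ne_zero.mpr hβ1.symm
  have h3 : (α - γ1 * γ2) ≠ 0 := sub_ne_zero.mpr hαγ12
  have h4 : (α - γ2) ≠ 0 := sub_ne_zero.mpr hαγ2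
  have h5 : (β - γ2) ≠ 0 := sub_ne_zero.mpr hβγ2
  have h6 : (1 - γ1) ≠ 0 := sub_ne_zero.mpr hγ1ne.symm
  have hmul : H13 * H13inv = 1 := by
    subst hH13 hH13inv
    ext i j
    fin_cases i <;> fin_cases j <;>
      simp [Hhat, Matrix.mul_apply, Fin.sum_univ_succ] <;> field_simp <;> ring
  refine ⟨hmul, mul_eq_one_comm.mp hmul, ?_⟩
  subst hH13 hH13inv
  ext i j
  fin_cases i <;> fin_cases j <;>
    simp [Hhat, -mul_eq_zero] <;> field_simp <;> ring
end

section
/- Let α, β, γ1, γ2 be nonzero complex numbers with α ≠ 1, β ≠ 1, α ≠ γ1, α ≠ γ2, α ≠ γ1γ2, β ≠ γ1, β ≠ γ2, γ1 ≠ 1, and γ2 ≠ 1, and let Ĥ be the matrix defined in the context. Let Ĥ12 be the 2×2 matrix with entries Ĥ[1,1], Ĥ[1,2], Ĥ[2,1], Ĥ[2,2]. Then Ĥ12 is invertible with inverse ((α−γ1γ2)(1−β)/(αβγ1²(1−γ2))) · [[(αβ−γ1)γ1, (α−γ1)(β−γ1)], [−(α−γ1)(β−γ1)γ1, −(α−γ1)(β−γ1)(1−γ1)]],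 and (1/γ2)·I₄ + (1 − 1/γ2)·Ĥ·(e1ᵀ, e2ᵀ)·(Ĥ12)⁻¹·(e1; e2) = [[1,0,0,0],[0,1,0,0],[1, 0, 1/γ2, 0],[(αβ−γ1)/(αβ), (α−γ1)(β−γ1)/(αβγ1), 0, 1/γ2]], where (e1ᵀ, e2ᵀ) is the 4×2 matrix with columns e1ᵀ, e2ᵀ and (e1; e2) is the 2×4 matrix with rows e1, e2. -/
open Matrix

/-- The representation matrix `M₂` of the circuit transform `𝓜₂` of Appell's system
`𝓕₄` (Corollary 4.4), together with the explicit inverse of the submatrix `Ĥ₁₂`. -/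
theorem circuit_matrix_M2 (α β γ1 γ2 : ℂ)
    (hα : α ≠ 0) (hβ : β ≠ 0) (hγ1 : γ1 ≠ 0) (hγ2 : γ2 ≠ 0)
    (hα1 : α ≠ 1) (hβ1 : β ≠ 1) (hαγ1 : α ≠ γ1) (hαγ2 : α ≠ γ2)
    (hαγ12 : α ≠ γ1 * γ2) (hβγ1 : β ≠ γ1) (hβγ2 : β ≠ γ2)
    (hγ1ne : γ1 ≠ 1) (hγ2ne : γ2 ≠ 1)
    (H12 : Matrix (Fin 2) (Fin 2) ℂ)
    (hH12 : H12 = !![Hhat α β γ1 γ2 0 0, Hhat α β γ1 γ2 0 1;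
                     Hhat α β γ1 γ2 1 0, Hhat α β γ1 γ2 1 1])
    (H12inv : Matrix (Fin 2) (Fin 2) ℂ)
    (hH12inv : H12inv = ((α-γ1*γ2)*(1-β) / (α*β*γ1^2*(1-γ2))) •
      !![(α*β-γ1)*γ1, (α-γ1)*(β-γ1);
         -((α-γ1)*(β-γ1)*γ1), -((α-γ1)*(β-γ1)*(1-γ1))]) :
    H12 * H12inv = 1 ∧ H12inv * H12 = 1 ∧
      (1/γ2) • (1 : Matrix (Fin 4) (Fin 4) ℂ) +
        (1 - 1/γ2) • (Hhat α β γ1 γ2 * (!![1,0; 0,1; 0,0; 0,0] : Matrix (Fin 4) (Fin 2) ℂ) *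
          H12inv * (!![1,0,0,0; 0,1,0,0] : Matrix (Fin 2) (Fin 4) ℂ)) =
      !![1, 0, 0, 0;
         0, 1, 0, 0;
         1, 0, 1/γ2, 0;
         (α*β-γ1)/(α*β), (α-γ1)*(β-γ1)/(α*β*γ1), 0, 1/γ2] := by
  have h1 : 1 - α ≠ 0 := sub_ne_zero.mpr hα1.symm
  have h2 : 1 - β ≠ 0 := sub_ne_zero.mpr hβ1.symm
  have h3 : α - γ1 ≠ 0 := sub_ne_zero.mpr hαγ1
  have h4 : β - γ1 ≠ 0 := sub_ne_zero.mpr hβγ1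
  have h5 : α - γ1 * γ2 ≠ 0 := sub_ne_zero.mpr hαγ12
  have h6 : 1 - γ2 ≠ 0 := sub_ne_zero.mpr hγ2ne.symm
  have hmul : H12 * H12inv = 1 := by
    subst hH12 hH12inv
    ext i j
    fin_cases i <;> fin_cases j <;>
      simp [Hhat, Matrix.mul_apply, Fin.sum_univ_two] <;> field_simp <;> ring
  refine ⟨hmul, mul_eq_one_comm.mp hmul, ?_⟩
  clear hmul
  subst hH12inv
  unfold Hhat
  generalize α - γ1 * γ2 = D at h5 ⊢
  ext i j
  fin_cases i <;> fin_cases j <;> simp [-mul_eq_zero] <;> field_simp <;> ring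
end

section
/- Let α, β, γ1, γ2 be nonzero complex numbers with α ≠ 1, β ≠ 1, α ≠ γ1, α ≠ γ2, α ≠ γ1γ2, β ≠ γ1, β ≠ γ2, and let Ĥ be the matrix defined in the context. Then det Ĥ = α³β³(β−γ1γ2)γ1²γ2² / ((1−α)(α−γ1)(α−γ2)(α−γ1γ2)³(1−β)⁵(β−γ1)(β−γ2)). -/
open Matrix

/-- The determinant of the intersection matrix `Ĥ` of the twisted cycles
`Δ̂₁,…,Δ̂₄` for Appell's system `𝓕₄`. -/
theorem det_Hhat (α β γ1 γ2 : ℂ)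
    (hα : α ≠ 0) (hβ : β ≠ 0) (hγ1 : γ1 ≠ 0) (hγ2 : γ2 ≠ 0)
    (hα1 : α ≠ 1) (hβ1 : β ≠ 1) (hαγ1 : α ≠ γ1) (hαγ2 : α ≠ γ2)
    (hαγ12 : α ≠ γ1 * γ2) (hβγ1 : β ≠ γ1) (hβγ2 : β ≠ γ2) :
    (Hhat α β γ1 γ2).det =
      α^3 * β^3 * (β - γ1*γ2) * γ1^2 * γ2^2 /
        ((1-α) * (α-γ1) * (α-γ2) * (α-γ1*γ2)^3 * (1-β)^5 * (β-γ1) * (β-γ2)) := by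
  have h1 : 1 - α ≠ 0 := sub_ne_zero.mpr hα1.symm
  have h2 : 1 - β ≠ 0 := sub_ne_zero.mpr hβ1.symm
  have h3 : α - γ1 ≠ 0 := sub_ne_zero.mpr hαγ1
  have h4 : α - γ2 ≠ 0 := sub_ne_zero.mpr hαγ2
  have h5 : α - γ1 * γ2 ≠ 0 := sub_ne_zero.mpr hαγ12
  have h6 : β - γ1 ≠ 0 := sub_ne_zero.mpr hβγ1
  have h7 : β - γ2 ≠ 0 := sub_ne_zero.mpr hβγ2
  simp only [Hhat, det_succ_row_zero, Fin.sum_univ_succ, det_fin_zero]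
  simp [Fin.succAbove, Fin.lt_def]
  field_simp
  ring
end

section
/- Let a, b, c1, c2, r ∈ ℂ with r ≠ 0, a ≠ 1, a ≠ c1, a ≠ c2, a ≠ c1+c2−1, b ≠ 0, b ≠ c1−1, b ≠ c2−1, and b ≠ c1+c2−2. Let C be the symmetric 4×4 complex matrix with entries C11 = (−a+1+b)(2b−c1−c2+2)/((−a+c1+c2−1)(b−c1+1)(b−c2+1)(b−c1−c2+2)), C12 = C21 = 1/((b−c2+1)(−a+c1+c2−1)), C13 = C31 = 1/((b−c1+1)(−a+c1+c2−1)), C14 = C41 = 0, C22 = (c1−1)(a+b−c2)/((a−1)(a−c2)(b−c2+1)(−a+c1+c2−1)), C23 = C32 = −1/((a−1)(−a+c1+c2−1)), C24 = C42 = 0, C33 = (c2−1)(a+b−c1)/((a−1)(a−c1)(b−c1+1)(−a+c1+c2−1)), C34 = C43 = 0, C44 = 2/((−a+c1+c2−1)(−b)·r). Then det C = −4b / ((a−1)(a−c1)(a−c2)(−a+c1+c2−1)³(b−c1+1)(b−c2+1)(b−c1−c2+2)·r). -/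
open Matrix

/-- Determinant of the intersection matrix `C` of the twisted cohomology classes
`φ₁,…,φ₄` associated with Appell's system `𝓕₄` (Theorem 5.2), where `r` plays the
role of `R(x)`. -/
theorem det_cohomology_intersection_matrix (a b c1 c2 r : ℂ)
    (hr : r ≠ 0) (ha1 : a ≠ 1) (hac1 : a ≠ c1) (hac2 : a ≠ c2)
    (hac12 : a ≠ c1 + c2 - 1) (hb : b ≠ 0) (hbc1 : b ≠ c1 - 1) (hbc2 : b ≠ c2 - 1)
    (hbc12 : b ≠ c1 + c2 - 2)
    (C : Matrix (Fin 4) (Fin 4) ℂ)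
    (hC : C = !![(-a+1+b)*(2*b-c1-c2+2) / ((-a+c1+c2-1)*(b-c1+1)*(b-c2+1)*(b-c1-c2+2)),
                 1 / ((b-c2+1)*(-a+c1+c2-1)),
                 1 / ((b-c1+1)*(-a+c1+c2-1)),
                 0;
                 1 / ((b-c2+1)*(-a+c1+c2-1)),
                 (c1-1)*(a+b-c2) / ((a-1)*(a-c2)*(b-c2+1)*(-a+c1+c2-1)),
                 -1 / ((a-1)*(-a+c1+c2-1)),
                 0;
                 1 / ((b-c1+1)*(-a+c1+c2-1)),
                 -1 / ((a-1)*(-a+c1+c2-1)),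
                 (c2-1)*(a+b-c1) / ((a-1)*(a-c1)*(b-c1+1)*(-a+c1+c2-1)),
                 0;
                 0, 0, 0,
                 2 / ((-a+c1+c2-1)*(-b)*r)]) :
    C.det = -4*b /
      ((a-1)*(a-c1)*(a-c2)*(-a+c1+c2-1)^3*(b-c1+1)*(b-c2+1)*(b-c1-c2+2)*r) := by
  have h1 : a - 1 ≠ 0 := sub_ne_zero.2 ha1
  have h2 : a - c1 ≠ 0 := sub_ne_zero.2 hac1
  have h3 : a - c2 ≠ 0 := sub_ne_zero.2 hac2
  have h4 : -a + c1 + c2 - 1 ≠ 0 := fun h => hac12 (by linear_combination -h)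
  have h5 : b - c1 + 1 ≠ 0 := fun h => hbc1 (by linear_combination h)
  have h6 : b - c2 + 1 ≠ 0 := fun h => hbc2 (by linear_combination h)
  have h7 : b - c1 - c2 + 2 ≠ 0 := fun h => hbc12 (by linear_combination h)
  subst hC
  simp [Matrix.det_succ_row_zero, Fin.sum_univ_succ, Fin.succAbove]
  field_simp
  ring
end

section
/- Let μ1, μ2, μ3, μ4 be nonzero complex numbers; set μ0 = (μ1μ2μ3μ4²)⁻¹, and write μ_{ij} = μiμj and μ_{ijk} = μiμjμk. Assume that none of μ0, μ1, μ2, μ4, μ_{124}, μ_{014}, μ_{024} equals 1. Let H be the 3×3 complex matrix with entries H11 = 1 + 1/(μ0−1) + 1/(μ1−1) + 1/(μ2−1) + (μ_{12}−1)/((μ_{124}−1)(μ1−1)(μ2−1)) + (μ_{01}−1)/((μ_{014}−1)(μ0−1)(μ1−1)) + (μ_{02}−1)/((μ_{024}−1)(μ0−1)(μ2−1)), H12 = −(1/(μ1−1))·(1 + 1/(μ_{124}−1) + 1/(μ_{014}−1)), H13 = −(1/(μ2−1))·(1 + 1/(μ_{124}−1) + 1/(μ_{024}−1)), H22 = 1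 + 1/(μ1−1) + 1/(μ4−1) + (μ_{14}−1)/((μ_{124}−1)(μ1−1)(μ4−1)) + (μ_{14}−1)/((μ_{014}−1)(μ1−1)(μ4−1)), H23 = −μ1μ4/((μ4−1)(μ_{124}−1)), H33 = 1 + 1/(μ2−1) + 1/(μ4−1) + (μ_{24}−1)/((μ_{124}−1)(μ2−1)(μ4−1)) + (μ_{24}−1)/((μ_{024}−1)(μ2−1)(μ4−1)), and for i < j, Hji = Hij^∨, where z^∨ denotes the result of replacing each μk (k = 0,…,4) by μk⁻¹ in the rational expression z. Then, with α = μ0, β = μ4⁻¹, γ1 = (μ1μ4)⁻¹, γ2 = (μ2μ4)⁻¹, one has det H = β²(α−γ1γ2)²(αβ+γ1γ2) / ((α−1)(α−γ1)(α−γ2)(β−1)²(β−γ1)(β−γ2)(β−γ1γ2)). -/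
lemma one_div_inv_sub_one {K : Type*} [Field K] {x : K} (hx : x ≠ 0) :
    1 / (x⁻¹ - 1) = -(x / (x - 1)) := by
  rw [← neg_sub 1 (x⁻¹), one_div, inv_neg, show 1 - x⁻¹ = (x - 1) / x by field_simp, inv_div]

/-- Determinant of the intersection matrix `H = (I_h(Δᵢᵘ, Δⱼ^{1/u}))_{6≤i,j≤8}` of the
twisted cycles `Δ₆, Δ₇, Δ₈` from the proof of Lemma 4.1 for Appell's system `𝓕₄`.
The lower-triangular entries are obtained from the upper ones by replacing each `μₖ`
by `μₖ⁻¹`. -/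
theorem det_H678 (μ1 μ2 μ3 μ4 μ0 : ℂ)
    (hμ1 : μ1 ≠ 0) (hμ2 : μ2 ≠ 0) (hμ3 : μ3 ≠ 0) (hμ4 : μ4 ≠ 0)
    (hμ0 : μ0 = (μ1 * μ2 * μ3 * μ4^2)⁻¹)
    (h0 : μ0 ≠ 1) (h1 : μ1 ≠ 1) (h2 : μ2 ≠ 1) (h4 : μ4 ≠ 1)
    (h124 : μ1 * μ2 * μ4 ≠ 1) (h014 : μ0 * μ1 * μ4 ≠ 1) (h024 : μ0 * μ2 * μ4 ≠ 1)
    (H : Matrix (Fin 3) (Fin 3) ℂ)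
    (hH : H = !![1 + 1/(μ0-1) + 1/(μ1-1) + 1/(μ2-1)
                   + (μ1*μ2-1) / ((μ1*μ2*μ4-1)*(μ1-1)*(μ2-1))
                   + (μ0*μ1-1) / ((μ0*μ1*μ4-1)*(μ0-1)*(μ1-1))
                   + (μ0*μ2-1) / ((μ0*μ2*μ4-1)*(μ0-1)*(μ2-1)),
                 -(1/(μ1-1)) * (1 + 1/(μ1*μ2*μ4-1) + 1/(μ0*μ1*μ4-1)),
                 -(1/(μ2-1)) * (1 + 1/(μ1*μ2*μ4-1) + 1/(μ0*μ2*μ4-1));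
                 -(1/(μ1⁻¹-1)) * (1 + 1/((μ1*μ2*μ4)⁻¹-1) + 1/((μ0*μ1*μ4)⁻¹-1)),
                 1 + 1/(μ1-1) + 1/(μ4-1)
                   + (μ1*μ4-1) / ((μ1*μ2*μ4-1)*(μ1-1)*(μ4-1))
                   + (μ1*μ4-1) / ((μ0*μ1*μ4-1)*(μ1-1)*(μ4-1)),
                 -(μ1*μ4) / ((μ4-1)*(μ1*μ2*μ4-1));
                 -(1/(μ2⁻¹-1)) * (1 + 1/((μ1*μ2*μ4)⁻¹-1) + 1/((μ0*μ2*μ4)⁻¹-1)),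
                 -(μ1⁻¹*μ4⁻¹) / ((μ4⁻¹-1)*((μ1*μ2*μ4)⁻¹-1)),
                 1 + 1/(μ2-1) + 1/(μ4-1)
                   + (μ2*μ4-1) / ((μ1*μ2*μ4-1)*(μ2-1)*(μ4-1))
                   + (μ2*μ4-1) / ((μ0*μ2*μ4-1)*(μ2-1)*(μ4-1))])
    (α β γ1 γ2 : ℂ)
    (hα : α = μ0) (hβ : β = μ4⁻¹) (hγ1 : γ1 = (μ1*μ4)⁻¹) (hγ2 : γ2 = (μ2*μ4)⁻¹) :
    H.det = β^2 * (α - γ1*γ2)^2 * (α*β + γ1*γ2) /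
      ((α-1)*(α-γ1)*(α-γ2)*(β-1)^2*(β-γ1)*(β-γ2)*(β-γ1*γ2)) := by
  have hμ0' : μ0 ≠ 0 := by
    rw [hμ0]
    positivity
  have h0' := sub_ne_zero.2 h0
  have h1' := sub_ne_zero.2 h1
  have h2' := sub_ne_zero.2 h2
  have h4' := sub_ne_zero.2 h4
  have h124' := sub_ne_zero.2 h124
  have h014' := sub_ne_zero.2 h014
  have h024' := sub_ne_zero.2 h024
  clear hμ0 hμ3
  subst hα hβ hγ1 hγ2
  have d4 : μ4⁻¹ - 1 = -(μ4 - 1) / μ4 := by field_simp; ring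
  have d124 : (μ1*μ2*μ4)⁻¹ - 1 = -(μ1*μ2*μ4 - 1) / (μ1*μ2*μ4) := by field_simp; ring
  have rhs : μ4⁻¹^2 * (α - (μ1*μ4)⁻¹*(μ2*μ4)⁻¹)^2 * (α*μ4⁻¹ + (μ1*μ4)⁻¹*(μ2*μ4)⁻¹) /
      ((α-1)*(α-(μ1*μ4)⁻¹)*(α-(μ2*μ4)⁻¹)*(μ4⁻¹-1)^2*(μ4⁻¹-(μ1*μ4)⁻¹)*(μ4⁻¹-(μ2*μ4)⁻¹)*
        (μ4⁻¹-(μ1*μ4)⁻¹*(μ2*μ4)⁻¹)) =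
      (α*μ1*μ2*μ4^2-1)^2 * (α*μ1*μ2*μ4+1) /
        ((α-1)*(α*μ1*μ4-1)*(α*μ2*μ4-1)*(μ4-1)^2*(μ1-1)*(μ2-1)*(μ1*μ2*μ4-1)) := by
    have dα1 : α - (μ1*μ4)⁻¹ = (α*μ1*μ4 - 1) / (μ1*μ4) := by field_simp
    have dα2 : α - (μ2*μ4)⁻¹ = (α*μ2*μ4 - 1) / (μ2*μ4) := by field_simp
    have dβ1 : μ4⁻¹ - (μ1*μ4)⁻¹ = (μ1 - 1) / (μ1*μ4) := by field_simp
    have dβ2 : μ4⁻¹ - (μ2*μ4)⁻¹ = (μ2 - 1) / (μ2*μ4) := by field_simp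
    have dβ12 : μ4⁻¹ - (μ1*μ4)⁻¹*(μ2*μ4)⁻¹ = (μ1*μ2*μ4 - 1) / (μ1*μ2*μ4^2) := by field_simp
    rw [dα1, dα2, d4, dβ1, dβ2, dβ12]
    field_simp
  rw [rhs, hH, Matrix.det_fin_three]
  simp only [Matrix.of_apply, Matrix.cons_val', Matrix.cons_val_zero, Matrix.cons_val_one,
    Matrix.cons_val]
  rw [one_div_inv_sub_one hμ1, one_div_inv_sub_one hμ2,
    one_div_inv_sub_one (by positivity : μ1*μ2*μ4 ≠ 0),
    one_div_inv_sub_one (by positivity : α*μ1*μ4 ≠ 0),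
    one_div_inv_sub_one (by positivity : α*μ2*μ4 ≠ 0),
    show -(μ1⁻¹*μ4⁻¹) / ((μ4⁻¹-1)*((μ1*μ2*μ4)⁻¹-1)) =
      -(μ2*μ4) / ((μ4-1)*(μ1*μ2*μ4-1)) by
        rw [d4, d124]
        field_simp]
  field_simp
  ring
end

section
/- Define, for a, b, c1, c2 ∈ ℂ and x = (x1,x2), the regularized Appell series F̃4(a,b,c1,c2;x) = Σ_{(n1,n2)∈ℕ²} Γ(a+n1+n2)Γ(b+n1+n2) / (Γ(c1+n1)Γ(c2+n2)Γ(1+n1)Γ(1+n2)) · x1^{n1} x2^{n2}, where 1/Γ is the entire reciprocal Gamma function (so F̃4 is defined for all c1 ∈ ℂ). Let a, b, c2 ∈ ℂ ∖ ℤ, let m ∈ ℤ, and let x1, x2 be real with x1 > 0, x2 > 0 and √x1 + √x2 < 1. Then, as c1 → m through ℂ ∖ ℤ, x1^{1−c1} · F̃4(a+1−c1, b+1−c1, 2−c1, c2; (x1,x2)) converges to F̃4(a, b, m, c2; (x1,x2)), where x1^{1−c1} = exp((1−c1)·log x1). -/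
open Complex Filter Topology

/-- The regularized Appell series
`F̃₄(a,b,c₁,c₂;x) = Σ Γ(a+n₁+n₂)Γ(b+n₁+n₂)/(Γ(c₁+n₁)Γ(c₂+n₂)Γ(1+n₁)Γ(1+n₂)) x₁^{n₁}x₂^{n₂}`.
Since Mathlib's `Complex.Gamma` vanishes at the poles `0, -1, -2, …`, the division
implements the entire reciprocal Gamma function, so `F̃₄` is defined for all `c₁`. -/
noncomputable def appellF4Reg (a b c1 c2 : ℂ) (x : ℂ × ℂ) : ℂ :=
  ∑' n : ℕ × ℕ,
    Complex.Gamma (a + n.1 + n.2) * Complex.Gamma (b + n.1 + n.2) /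
      (Complex.Gamma (c1 + n.1) * Complex.Gamma (c2 + n.2) *
        Complex.Gamma (1 + n.1) * Complex.Gamma (1 + n.2)) * x.1 ^ n.1 * x.2 ^ n.2

/-- Iterating the functional equation of `Γ` gives factorial growth along `s + ℕ`. -/
theorem norm_Gamma_add_nat_le {s : ℂ} {R : ℕ} (hs : ‖s‖ ≤ R) (hG : Complex.Gamma s ≠ 0) (n : ℕ) :
    ‖Complex.Gamma (s + n)‖ ≤ ‖Complex.Gamma s‖ * (n.factorial * ((n : ℝ) + 1) ^ R) := by
  induction n with
  | zero => simp
  | succ n ih =>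
    have hne : s + n ≠ 0 := fun h => hG <| by
      rw [eq_neg_of_add_eq_zero_left h, Complex.Gamma_neg_nat_eq_zero]
    have hnorm : ‖s + n‖ ≤ n + 1 + R := by
      calc ‖s + n‖ ≤ ‖s‖ + ‖(n : ℂ)‖ := norm_add_le _ _
        _ ≤ n + 1 + R := by rw [Complex.norm_natCast]; linarith
    have hbern : ((n : ℝ) + 1 + R) * ((n : ℝ) + 1) ^ R ≤ (n + 1) * ((n : ℝ) + 2) ^ R := by
      have hn : (0 : ℝ) < n + 1 := by positivity
      have h1 := one_add_mul_le_pow (a := 1 / ((n : ℝ) + 1))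
        (by have : 0 < 1 / ((n : ℝ) + 1) := by positivity
            linarith) R
      have h2 : (n : ℝ) + 2 = (n + 1) * (1 + 1 / ((n : ℝ) + 1)) := by field_simp; ring
      have h3 : (n : ℝ) + 1 + R = (n + 1) * (1 + R * (1 / ((n : ℝ) + 1))) := by field_simp
      rw [h2, h3, mul_pow, mul_assoc, mul_comm (1 + _) _]
      gcongr
    have hrec : Complex.Gamma (s + (n + 1 : ℕ)) = (s + n) * Complex.Gamma (s + n) := by
      rw [← Complex.Gamma_add_one _ hne]; push_cast; ring_nf
    rw [hrec, norm_mul]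
    calc ‖s + n‖ * ‖Complex.Gamma (s + n)‖
        ≤ (n + 1 + R) * (‖Complex.Gamma s‖ * (n.factorial * ((n : ℝ) + 1) ^ R)) := by gcongr
      _ = ‖Complex.Gamma s‖ * n.factorial * (((n : ℝ) + 1 + R) * ((n : ℝ) + 1) ^ R) := by ring
      _ ≤ ‖Complex.Gamma s‖ * n.factorial * ((n + 1) * ((n : ℝ) + 2) ^ R) := by gcongr
      _ = _ := by rw [Nat.factorial_succ]; push_cast; ring

/-- In the half plane `1 ≤ re t`, the reciprocal Gamma function decays factorially. -/
theorem norm_inv_Gamma_add_nat_le {t : ℂ} (ht : 1 ≤ t.re) (n : ℕ) :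
    ‖(Complex.Gamma (t + n))⁻¹‖ ≤ ‖(Complex.Gamma t)⁻¹‖ / n.factorial := by
  induction n with
  | zero => simp
  | succ n ih =>
    have hnorm : (n : ℝ) + 1 ≤ ‖t + n‖ := by
      refine le_trans ?_ (Complex.re_le_norm _)
      simp only [add_re, natCast_re]; linarith
    have hne : t + n ≠ 0 := norm_pos_iff.1 (lt_of_lt_of_le (by positivity) hnorm)
    have hrec : Complex.Gamma (t + (n + 1 : ℕ)) = (t + n) * Complex.Gamma (t + n) := by
      rw [← Complex.Gamma_add_one _ hne]; push_cast; ring_nf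
    rw [hrec, mul_inv, norm_mul, norm_inv, Nat.factorial_succ]
    calc ‖t + n‖⁻¹ * ‖(Complex.Gamma (t + n))⁻¹‖
        ≤ ((n : ℝ) + 1)⁻¹ * (‖(Complex.Gamma t)⁻¹‖ / n.factorial) := by gcongr
      _ = _ := by push_cast; field_simp

/-- The reciprocal Gamma function at `s` is controlled by its value at a translate. -/
theorem norm_inv_Gamma_le_pow_mul {s : ℂ} {M : ℝ} {k : ℕ} (hs : ‖s‖ + k ≤ M) :
    ‖(Complex.Gamma s)⁻¹‖ ≤ M ^ k * ‖(Complex.Gamma (s + k))⁻¹‖ := by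
  induction k generalizing s with
  | zero => simp
  | succ k ih =>
    push_cast at hs
    have hM : 0 ≤ M := le_trans (by positivity) hs
    have h1 : ‖s + 1‖ + k ≤ M := by
      have := norm_add_le s 1
      rw [norm_one] at this; linarith
    have h2 := Complex.one_div_Gamma_eq_self_mul_one_div_Gamma_add_one s
    rw [h2, norm_mul, pow_succ', mul_assoc]
    have h3 := ih h1
    have h4 : s + 1 + k = s + (k + 1 : ℕ) := by push_cast; ring
    rw [h4] at h3
    gcongr
    have : (0 : ℝ) ≤ k := by positivity
    linarith

theorem exists_eventually_norm_Gamma_add_nat_le {s₀ : ℂ} (hs : ∀ n : ℕ, s₀ ≠ -n) :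
    ∃ (K : ℝ) (p : ℕ), 0 ≤ K ∧ ∀ᶠ s in 𝓝 s₀, ∀ n : ℕ,
      ‖Complex.Gamma (s + n)‖ ≤ K * (n.factorial * ((n : ℝ) + 1) ^ p) := by
  obtain ⟨R, hR⟩ := exists_nat_gt ‖s₀‖
  have hcont : ContinuousAt Complex.Gamma s₀ := (Complex.differentiableAt_Gamma s₀ hs).continuousAt
  refine ⟨‖Complex.Gamma s₀‖ + 1, R, by positivity, ?_⟩
  filter_upwards [continuous_norm.continuousAt.eventually_lt_const hR,
    hcont.eventually_ne (Complex.Gamma_ne_zero hs),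
    hcont.norm.eventually_lt_const (lt_add_one _)] with s h1 h2 h3 n
  exact (norm_Gamma_add_nat_le h1.le h2 n).trans (by gcongr)

theorem exists_eventually_norm_inv_Gamma_add_nat_le (s₀ : ℂ) :
    ∃ (K : ℝ) (p : ℕ), 0 ≤ K ∧ ∀ᶠ s in 𝓝 s₀, ∀ n : ℕ,
      ‖(Complex.Gamma (s + n))⁻¹‖ ≤ K * (((n : ℝ) + 1) ^ p / n.factorial) := by
  obtain ⟨R, hR⟩ := exists_nat_gt ‖s₀‖
  have hcont : ContinuousAt (fun s : ℂ => (Complex.Gamma (s + (R + 1 : ℕ)))⁻¹) s₀ :=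
    (Complex.differentiable_one_div_Gamma.continuous.comp
      (continuous_id.add continuous_const)).continuousAt
  refine ⟨(2 * R + 1) ^ (R + 1) * (‖(Complex.Gamma (s₀ + (R + 1 : ℕ)))⁻¹‖ + 1), R + 1,
    by positivity, ?_⟩
  filter_upwards [continuous_norm.continuousAt.eventually_lt_const hR,
    hcont.norm.eventually_lt_const (lt_add_one _)] with s h1 h2 n
  have hre : 1 ≤ (s + (R + 1 : ℕ)).re := by
    have := (abs_le.1 ((Complex.abs_re_le_norm s).trans h1.le)).1
    simp only [add_re, natCast_re]; push_cast; linarith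
  have hM : ‖s + n‖ + (R + 1 : ℕ) ≤ (2 * R + 1) * ((n : ℝ) + 1) := by
    have h4 := norm_add_le s n
    rw [Complex.norm_natCast] at h4
    have : (0 : ℝ) ≤ R * n := by positivity
    push_cast; nlinarith
  calc ‖(Complex.Gamma (s + n))⁻¹‖
      ≤ ((2 * R + 1) * ((n : ℝ) + 1)) ^ (R + 1) *
          ‖(Complex.Gamma (s + n + (R + 1 : ℕ)))⁻¹‖ := norm_inv_Gamma_le_pow_mul hM
    _ ≤ ((2 * R + 1) * ((n : ℝ) + 1)) ^ (R + 1) *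
          (‖(Complex.Gamma (s + (R + 1 : ℕ)))⁻¹‖ / n.factorial) := by
        rw [add_right_comm]
        gcongr
        exact norm_inv_Gamma_add_nat_le hre n
    _ ≤ ((2 * R + 1) * ((n : ℝ) + 1)) ^ (R + 1) *
          ((‖(Complex.Gamma (s₀ + (R + 1 : ℕ)))⁻¹‖ + 1) / n.factorial) := by gcongr
    _ = _ := by rw [mul_pow]; ring

theorem summable_succ_pow_mul_geometric (p : ℕ) {r : ℝ} (h0 : 0 ≤ r) (h1 : r < 1) :
    Summable fun n : ℕ => ((n : ℝ) + 1) ^ p * r ^ n := by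
  rcases h0.eq_or_lt with rfl | h0
  · exact summable_of_ne_finset_zero (s := {0}) fun n hn => by simp_all
  have h := (summable_nat_add_iff 1).2 (summable_pow_mul_geometric_of_norm_lt_one p
    (r := r) (by rwa [Real.norm_of_nonneg h0.le]))
  refine (h.mul_right r⁻¹).congr fun n => ?_
  push_cast
  rw [pow_succ]
  field_simp

theorem choose_mul_pow_mul_pow_le {u v : ℝ} (hu : 0 ≤ u) (hv : 0 ≤ v) (i j : ℕ) :
    ((i + j).choose i : ℝ) * (u ^ i * v ^ j) ≤ (u + v) ^ (i + j) := by
  rw [add_pow]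
  have := Finset.single_le_sum (s := Finset.range (i + j + 1))
    (f := fun k => u ^ k * v ^ (i + j - k) * ((i + j).choose k : ℝ))
    (fun k _ => by positivity) (Finset.mem_range.2 (by omega : i < i + j + 1))
  simp only [Nat.add_sub_cancel_left] at this
  linarith

theorem factorial_sq_div_mul_pow_le {x y : ℝ} (hx : 0 ≤ x) (hy : 0 ≤ y) (i j : ℕ) :
    ((i + j).factorial / (i.factorial * j.factorial) : ℝ) ^ 2 * (x ^ i * y ^ j) ≤
      ((√x + √y) ^ 2) ^ i * ((√x + √y) ^ 2) ^ j := by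
  have hchoose : ((i + j).factorial / (i.factorial * j.factorial) : ℝ) = (i + j).choose i := by
    rw [div_eq_iff (by positivity), ← mul_assoc]
    rw [Nat.choose_symm_add]
    exact_mod_cast (Nat.add_choose_mul_factorial_mul_factorial i j).symm
  have h := pow_le_pow_left₀ (by positivity)
    (choose_mul_pow_mul_pow_le (Real.sqrt_nonneg x) (Real.sqrt_nonneg y) i j) 2
  calc _ = (((i + j).choose i : ℝ) * (√x ^ i * √y ^ j)) ^ 2 := by
        rw [hchoose, mul_pow, mul_pow, ← pow_mul, ← pow_mul, mul_comm i, mul_comm j, pow_mul,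
          pow_mul, Real.sq_sqrt hx, Real.sq_sqrt hy]
    _ ≤ _ := h
    _ = _ := by rw [← pow_add, ← pow_mul, ← pow_mul, mul_comm]

theorem mul_factorial_growth_le {K x y : ℝ} (hK : 0 ≤ K) (hx : 0 ≤ x) (hy : 0 ≤ y)
    (p q r s i j : ℕ) :
    K * ((((i : ℝ) + j + 1) ^ p * ((i : ℝ) + j + 1) ^ q * ((i : ℝ) + 1) ^ r * ((j : ℝ) + 1) ^ s) *
        (((i + j).factorial / (i.factorial * j.factorial) : ℝ) ^ 2 * (x ^ i * y ^ j))) ≤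
      K * ((((i : ℝ) + 1) ^ (p + q + r + s) * ((√x + √y) ^ 2) ^ i) *
        (((j : ℝ) + 1) ^ (p + q + r + s) * ((√x + √y) ^ 2) ^ j)) := by
  set T : ℝ := ((i : ℝ) + 1) * (j + 1) with hT
  have hij : (0 : ℝ) ≤ i * j := by positivity
  have hi0 : (0 : ℝ) ≤ i := by positivity
  have hj0 : (0 : ℝ) ≤ j := by positivity
  have t1 : (i : ℝ) + j + 1 ≤ T := by rw [hT]; linarith
  have t2 : (i : ℝ) + 1 ≤ T := by rw [hT]; linarith
  have t3 : (j : ℝ) + 1 ≤ T := by rw [hT]; linarith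
  calc _ ≤ K * ((T ^ p * T ^ q * T ^ r * T ^ s) *
        (((√x + √y) ^ 2) ^ i * ((√x + √y) ^ 2) ^ j)) := by
        gcongr ?_ * (?_ * ?_)
        · gcongr
        · exact factorial_sq_div_mul_pow_le hx hy i j
    _ = _ := by rw [← pow_add, ← pow_add, ← pow_add, hT, mul_pow]; ring

/-- Inside its convergence domain the regularized Appell series is continuous in the first
three parameters, away from the poles of the numerator. -/
theorem tendsto_appellF4Reg {ι : Type*} {l : Filter ι} {A B C : ι → ℂ} {a b c : ℂ}
    (hA : Tendsto A l (𝓝 a)) (hB : Tendsto B l (𝓝 b)) (hC : Tendsto C l (𝓝 c))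
    (ha : ∀ n : ℕ, a ≠ -n) (hb : ∀ n : ℕ, b ≠ -n) (d : ℂ) {x y : ℝ} (hx : 0 ≤ x) (hy : 0 ≤ y)
    (hxy : √x + √y < 1) :
    Tendsto (fun i => appellF4Reg (A i) (B i) (C i) d ((x : ℂ), (y : ℂ))) l
      (𝓝 (appellF4Reg a b c d ((x : ℂ), (y : ℂ)))) := by
  obtain ⟨Ka, pa, hKa, hea⟩ := exists_eventually_norm_Gamma_add_nat_le ha
  obtain ⟨Kb, pb, hKb, heb⟩ := exists_eventually_norm_Gamma_add_nat_le hb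
  obtain ⟨Kc, pc, hKc, hec⟩ := exists_eventually_norm_inv_Gamma_add_nat_le c
  obtain ⟨Kd, pd, hKd, hed⟩ := exists_eventually_norm_inv_Gamma_add_nat_le d
  replace hed := hed.self_of_nhds
  set ρ := (√x + √y) ^ 2
  have hρ1 : ρ < 1 := pow_lt_one₀ (by positivity) hxy two_ne_zero
  set P := pa + pb + pc + pd
  have hg := summable_succ_pow_mul_geometric P (sq_nonneg _) hρ1
  have hsum := (hg.mul_of_nonneg hg (fun n => by positivity)
    (fun n => by positivity)).mul_left (Ka * Kb * Kc * Kd)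
  unfold appellF4Reg
  refine tendsto_tsum_of_dominated_convergence hsum ?_ ?_
  · rintro ⟨i, j⟩
    have num : ∀ {s : ℂ} {S : ι → ℂ}, Tendsto S l (𝓝 s) → (∀ n : ℕ, s ≠ -n) →
        Tendsto (fun k => Complex.Gamma (S k + i + j)) l (𝓝 (Complex.Gamma (s + i + j))) := by
      intro s S hS hs
      refine (Complex.differentiableAt_Gamma _ fun n h => hs (n + i + j) ?_).continuousAt.tendsto.comp
        ((hS.add_const _).add_const _)
      push_cast
      linear_combination h
    have den : Tendsto (fun k => (Complex.Gamma (C k + i))⁻¹) l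
        (𝓝 (Complex.Gamma (c + i))⁻¹) :=
      (Complex.differentiable_one_div_Gamma.continuous.tendsto _).comp (hC.add_const _)
    simp only [div_eq_mul_inv, mul_inv]
    exact (((num hA ha).mul (num hB hb)).mul
      (((den.mul_const _).mul_const _).mul_const _)).mul_const _ |>.mul_const _
  · filter_upwards [hA.eventually hea, hB.eventually heb, hC.eventually hec] with k h1 h2 h3
    rintro ⟨i, j⟩
    have h1 := h1 (i + j)
    have h2 := h2 (i + j)
    have h3 := h3 i
    have h4 := hed j
    push_cast at h1 h2
    rw [← add_assoc] at h1 h2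
    have gi : Complex.Gamma (1 + i) = i.factorial := by
      rw [add_comm, Complex.Gamma_nat_eq_factorial]
    have gj : Complex.Gamma (1 + j) = j.factorial := by
      rw [add_comm, Complex.Gamma_nat_eq_factorial]
    simp only [div_eq_mul_inv, mul_inv, norm_mul, norm_pow, gi, gj, Complex.norm_real,
      Real.norm_of_nonneg hx, Real.norm_of_nonneg hy]
    rw [norm_inv (i.factorial : ℂ), norm_inv (j.factorial : ℂ), Complex.norm_natCast,
      Complex.norm_natCast]
    refine le_trans ?_ (mul_factorial_growth_le
      (mul_nonneg (mul_nonneg (mul_nonneg hKa hKb) hKc) hKd) hx hy pa pb pc pd i j)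
    calc _ ≤ (Ka * ((i + j).factorial * ((i : ℝ) + j + 1) ^ pa)) *
            (Kb * ((i + j).factorial * ((i : ℝ) + j + 1) ^ pb)) *
            ((Kc * (((i : ℝ) + 1) ^ pc / i.factorial)) *
              (Kd * (((j : ℝ) + 1) ^ pd / j.factorial)) *
              (i.factorial : ℝ)⁻¹ * (j.factorial : ℝ)⁻¹) * x ^ i * y ^ j := by gcongr
      _ = _ := by simp only [div_eq_mul_inv, mul_inv]; ring

/-- At an integral third parameter, the two local exponents give the same regularized
solution. -/
theorem zpow_mul_appellF4Reg_int (a b d : ℂ) (m : ℤ) {x : ℂ} (hx : x ≠ 0) (y : ℂ) :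
    x ^ (1 - m) * appellF4Reg (a + 1 - m) (b + 1 - m) (2 - m) d (x, y) =
      appellF4Reg a b m d (x, y) := by
  let G : ℤ × ℕ → ℂ := fun n =>
    Complex.Gamma (a + n.1 + n.2) * Complex.Gamma (b + n.1 + n.2) /
      (Complex.Gamma (m + n.1) * Complex.Gamma (d + n.2) *
        Complex.Gamma (1 + n.1) * Complex.Gamma (1 + n.2)) * x ^ n.1 * y ^ n.2
  have hpole : ∀ k : ℤ, k ≤ 0 → Complex.Gamma k = 0 := by
    intro k hk
    obtain ⟨n, rfl⟩ : ∃ n : ℕ, k = -n := ⟨k.natAbs, by omega⟩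
    simpa using Complex.Gamma_neg_nat_eq_zero n
  have hsupp : ∀ n ∈ Function.support G, 0 ≤ n.1 ∧ 1 - m ≤ n.1 := by
    intro n hn
    constructor <;> by_contra! h
    · have h0 := hpole (1 + n.1) (by omega)
      rw [Int.cast_add, Int.cast_one] at h0
      exact hn (by simp only [G, h0, mul_zero, zero_mul, div_zero])
    · have h0 := hpole (m + n.1) (by omega)
      rw [Int.cast_add] at h0
      exact hn (by simp only [G, h0, zero_mul, div_zero])
  have e1 : appellF4Reg a b m d (x, y) = ∑' n, G n := by
    have hinj : Function.Injective fun n : ℕ × ℕ => ((n.1 : ℤ), n.2) := by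
      rintro ⟨i, j⟩ ⟨i', j'⟩ h
      simpa using h
    rw [← hinj.tsum_eq fun n hn => ⟨(n.1.toNat, n.2), Prod.ext
      (Int.toNat_of_nonneg (hsupp n hn).1) rfl⟩]
    simp [appellF4Reg, G]
  have e2 : x ^ (1 - m) * appellF4Reg (a + 1 - m) (b + 1 - m) (2 - m) d (x, y) = ∑' n, G n := by
    have hinj : Function.Injective fun n : ℕ × ℕ => ((n.1 : ℤ) + (1 - m), n.2) := by
      rintro ⟨i, j⟩ ⟨i', j'⟩ h
      simpa using h
    rw [← hinj.tsum_eq fun n hn => ⟨((n.1 - (1 - m)).toNat, n.2), Prod.ext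
      (by have := (hsupp n hn).2; simp only; omega) rfl⟩, appellF4Reg, ← tsum_mul_left]
    refine tsum_congr fun n => ?_
    have r1 : ∀ s : ℂ, s + ((n.1 + (1 - m) : ℤ) : ℂ) = s + 1 - m + n.1 := by
      intro s; push_cast; ring
    have r2 : (m : ℂ) + 1 - m + n.1 = 1 + n.1 := by ring
    have r3 : (1 : ℂ) + 1 - m + n.1 = 2 - m + n.1 := by ring
    simp only [G, r1, r2, r3, zpow_add₀ hx, zpow_natCast]
    ring
  rw [e1, e2]

/-- The key convergence claim in the proof of Lemma 4.5: as `c₁ → m ∈ ℤ` through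
`ℂ ∖ ℤ`, the solution `x₁^{1-c₁} F̃₄(a+1-c₁, b+1-c₁, 2-c₁, c₂; x)` converges to the
renormalized solution `F̃₄(a, b, m, c₂; x)`. -/
theorem appellF4Reg_tendsto_int_param (a b c2 : ℂ)
    (ha : ∀ n : ℤ, a ≠ (n : ℂ)) (hb : ∀ n : ℤ, b ≠ (n : ℂ))
    (hc2 : ∀ n : ℤ, c2 ≠ (n : ℂ)) (m : ℤ)
    (x1 x2 : ℝ) (hx1 : 0 < x1) (hx2 : 0 < x2)
    (hx : Real.sqrt x1 + Real.sqrt x2 < 1) :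
    Tendsto
      (fun c1 : ℂ => Complex.exp ((1 - c1) * (Real.log x1 : ℂ)) *
        appellF4Reg (a + 1 - c1) (b + 1 - c1) (2 - c1) c2 ((x1 : ℂ), (x2 : ℂ)))
      (nhdsWithin (m : ℂ) {z : ℂ | ∀ n : ℤ, z ≠ (n : ℂ)})
      (nhds (appellF4Reg a b (m : ℂ) c2 ((x1 : ℂ), (x2 : ℂ)))) := by
  have hpole : ∀ s : ℂ, (∀ n : ℤ, s ≠ n) → ∀ n : ℕ, s + 1 - m ≠ -n := fun s hs n h =>
    hs (m - 1 - n) (by push_cast; linear_combination h)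
  have hid : Tendsto (fun c : ℂ => c) (𝓝 (m : ℂ)) (𝓝 m) := tendsto_id
  have hF := tendsto_appellF4Reg (hid.const_sub (a + 1)) (hid.const_sub (b + 1))
    (hid.const_sub 2) (hpole a ha) (hpole b hb) c2 hx1.le hx2.le hx
  have hE : Tendsto (fun c : ℂ => Complex.exp ((1 - c) * (Real.log x1 : ℂ))) (𝓝 (m : ℂ))
      (𝓝 ((x1 : ℂ) ^ (1 - m))) := by
    have hval : (x1 : ℂ) ^ (1 - m) = Complex.exp ((1 - m) * (Real.log x1 : ℂ)) := by
      rw [← Complex.cpow_intCast, Complex.cpow_def_of_ne_zero (by exact_mod_cast hx1.ne'),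
        Complex.ofReal_log hx1.le, mul_comm]
      push_cast
      rfl
    rw [hval]
    exact (Complex.continuous_exp.tendsto _).comp ((hid.const_sub 1).mul_const _)
  have h := hE.mul hF
  rw [zpow_mul_appellF4Reg_int a b c2 m (by exact_mod_cast hx1.ne')] at h
  exact h.mono_left nhdsWithin_le_nhds
end

section
/- Let α, β, γ1, γ2 be nonzero complex numbers with α ≠ 1, β ≠ 1, α ≠ γ1, α ≠ γ2, α ≠ γ1γ2, β ≠ γ1, β ≠ γ2, β ≠ γ1γ2, γ1 ≠ 1, γ2 ≠ 1. Let H = diag(h1, h2, h3, h4) with h1 = −(1−α)γ1γ2/((α−γ1γ2)(1−γ1)(1−γ2)), h2 = αβγ1(1−γ1)(1−γ2)/((α−γ1)(α−γ1γ2)(β−γ1)(1−β)), h3 = αβγ2(1−γ1)(1−γ2)/((α−γ2)(α−γ1γ2)(1−β)(β−γ2)), h4 = −(β−γ1γ2)/((1−β)(1−γ1)(1−γ2)); let e5 = (1, −γ2(α−γ1)(β−γ1)/(αβ(γ2−1)(γ1−1)), −γ1(α−γ2)(β−γ2)/(αβ(γ2−1)(γ1−1)), 1) and e5∨ = (1,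 −(α−γ1)(β−γ1)/(γ1(γ1−1)(γ2−1)), −(α−γ2)(β−γ2)/(γ2(γ1−1)(γ2−1)), 1) be row vectors; set M = I₄ − ((β−1)(α−γ1γ2)/(αβ))·H·(e5∨)ᵀ·e5. Let P′ be the 4×4 matrix with rows (αβ(1−γ1)(1−γ2)/((1−α)(1−β)γ1γ2), 0, 0, 0), (−αβ(1−γ2)/((1−α)(1−β)γ2), γ1/(1−γ1), 0, 0), (−αβ(1−γ1)/((1−α)(1−β)γ1), 0, γ2/(1−γ2), 0), (αβ/((1−α)(1−β)), −γ1γ2/((1−γ1)(1−γ2)), −γ1γ2/((1−γ1)(1−γ2)), αβγ1γ2/((α−γ1γ2)(β−γ1γ2))). Then P′·M = N·P′, where N = [[−γ1γ2/(αβ), γ1γ2/(αβ) − 1/γ1, γ1γ2/(αβ) − 1/γ2, −(α−γ1γ2)(β−γ1γ2)/(αβγ1γ2)], [0,1,0,0], [0,0,1,0], [0,0,0,1]]. -/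
open Matrix

/-- Change of basis for the circuit transform `𝓜₃` of Appell's system `𝓕₄`
(Remark 4.6): with `H` the diagonal intersection matrix of the twisted cycles
`Δ₁,…,Δ₄`, `e₅`, `e₅∨` the coefficient vectors of `Δ₅ᵘ`, `Δ₅^{1/u}`, and
`M = I₄ - ((β-1)(α-γ₁γ₂)/(αβ))·H·(e₅∨)ᵀ·e₅` the representation matrix of `𝓜₃`
in the basis `(Δ₁ᵘ,…,Δ₄ᵘ)`, one has `P′·M = N·P′`. -/
theorem circuit_M3_change_of_basis (α β γ1 γ2 : ℂ)
    (hα : α ≠ 0) (hβ : β ≠ 0) (hγ1 : γ1 ≠ 0) (hγ2 : γ2 ≠ 0)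
    (hα1 : α ≠ 1) (hβ1 : β ≠ 1) (hαγ1 : α ≠ γ1) (hαγ2 : α ≠ γ2)
    (hαγ12 : α ≠ γ1 * γ2) (hβγ1 : β ≠ γ1) (hβγ2 : β ≠ γ2) (hβγ12 : β ≠ γ1 * γ2)
    (hγ1ne : γ1 ≠ 1) (hγ2ne : γ2 ≠ 1)
    (H : Matrix (Fin 4) (Fin 4) ℂ)
    (hH : H = Matrix.diagonal
      ![-((1-α)*γ1*γ2) / ((α-γ1*γ2)*(1-γ1)*(1-γ2)),
        α*β*γ1*(1-γ1)*(1-γ2) / ((α-γ1)*(α-γ1*γ2)*(β-γ1)*(1-β)),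
        α*β*γ2*(1-γ1)*(1-γ2) / ((α-γ2)*(α-γ1*γ2)*(1-β)*(β-γ2)),
        -(β-γ1*γ2) / ((1-β)*(1-γ1)*(1-γ2))])
    (e5 e5v : Fin 4 → ℂ)
    (he5 : e5 = ![1, -(γ2*(α-γ1)*(β-γ1)) / (α*β*(γ2-1)*(γ1-1)),
                  -(γ1*(α-γ2)*(β-γ2)) / (α*β*(γ2-1)*(γ1-1)), 1])
    (he5v : e5v = ![1, -((α-γ1)*(β-γ1)) / (γ1*(γ1-1)*(γ2-1)),
                    -((α-γ2)*(β-γ2)) / (γ2*(γ1-1)*(γ2-1)), 1])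
    (M : Matrix (Fin 4) (Fin 4) ℂ)
    (hM : M = 1 - ((β-1)*(α-γ1*γ2) / (α*β)) • vecMulVec (H.mulVec e5v) e5)
    (P' : Matrix (Fin 4) (Fin 4) ℂ)
    (hP' : P' = !![α*β*(1-γ1)*(1-γ2) / ((1-α)*(1-β)*γ1*γ2), 0, 0, 0;
                   -(α*β*(1-γ2)) / ((1-α)*(1-β)*γ2), γ1/(1-γ1), 0, 0;
                   -(α*β*(1-γ1)) / ((1-α)*(1-β)*γ1), 0, γ2/(1-γ2), 0;
                   α*β / ((1-α)*(1-β)), -(γ1*γ2) / ((1-γ1)*(1-γ2)),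
                     -(γ1*γ2) / ((1-γ1)*(1-γ2)),
                     α*β*γ1*γ2 / ((α-γ1*γ2)*(β-γ1*γ2))])
    (N : Matrix (Fin 4) (Fin 4) ℂ)
    (hN : N = !![-(γ1*γ2)/(α*β), γ1*γ2/(α*β) - 1/γ1, γ1*γ2/(α*β) - 1/γ2,
                   -((α-γ1*γ2)*(β-γ1*γ2)) / (α*β*γ1*γ2);
                 0, 1, 0, 0;
                 0, 0, 1, 0;
                 0, 0, 0, 1]) :
    P' * M = N * P' := by
  have hα1' : 1 - α ≠ 0 := sub_ne_zero.2 hα1.symm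
  have hβ1' : 1 - β ≠ 0 := sub_ne_zero.2 hβ1.symm
  have hγ1' : 1 - γ1 ≠ 0 := sub_ne_zero.2 hγ1ne.symm
  have hγ2' : 1 - γ2 ≠ 0 := sub_ne_zero.2 hγ2ne.symm
  have hγ1'' : γ1 - 1 ≠ 0 := sub_ne_zero.2 hγ1ne
  have hγ2'' : γ2 - 1 ≠ 0 := sub_ne_zero.2 hγ2ne
  have hαγ1' : α - γ1 ≠ 0 := sub_ne_zero.2 hαγ1
  have hαγ2' : α - γ2 ≠ 0 := sub_ne_zero.2 hαγ2
  have hβγ1' : β - γ1 ≠ 0 := sub_ne_zero.2 hβγ1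
  have hβγ2' : β - γ2 ≠ 0 := sub_ne_zero.2 hβγ2
  have hαγ12' : α - γ1 * γ2 ≠ 0 := sub_ne_zero.2 hαγ12
  have hβγ12' : β - γ1 * γ2 ≠ 0 := sub_ne_zero.2 hβγ12
  have hw : ((β-1)*(α-γ1*γ2) / (α*β)) • H.mulVec e5v =
      ![(1-α)*(1-β)*γ1*γ2 / (α*β*(1-γ1)*(1-γ2)), 1, 1,
        (α-γ1*γ2)*(β-γ1*γ2) / (α*β*(1-γ1)*(1-γ2))] := by
    subst hH he5v
    ext i
    fin_cases i <;> simp [mulVec_diagonal] <;> field_simp <;> ring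
  have hP'w : P' *ᵥ (((β-1)*(α-γ1*γ2) / (α*β)) • H.mulVec e5v) = Pi.single 0 1 := by
    rw [hw, hP']
    ext i
    fin_cases i <;> simp [mulVec, dotProduct, Fin.sum_univ_four] <;> field_simp <;> ring
  have hNP' : N * P' = P' - vecMulVec (Pi.single 0 1) e5 := by
    subst hN hP' he5
    ext i j
    fin_cases i <;> fin_cases j <;>
      simp [mul_apply, Fin.sum_univ_four] <;> field_simp <;> ring
  rw [hNP', hM, ← smul_vecMulVec, mul_sub, mul_one, mul_vecMulVec, hP'w]
end
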